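/- For every local dimension d there is a constant C (depending only on d) such that the following holds. Let ε > 0, let β > 0 be an inverse temperature, and let H = ∑_{e∈E} h_e be a 2-local Hamiltonian on n qudits of local dimension d with m ≥ C·n/ε³ interactions, each of operator norm ‖h_e‖_∞ ≤ 1. Then there exists a product mixed state σ_β = ⊗_{u=1}^n σ_u (each σ_u a d×d density matrix) such that F(β) ≤ Tr[H σ_β] − S(σ_β)/β ≤ F(β) + ε·m. -/

import Mathlib

open scoped BigOperators ComplexOrder

noncomputable section

namespace QLH

/-- The operator (spectral) norm of a square complex matrix. -/
def opNorm {m : Type*} [Fintype m] [DecidableEq m] (A : Matrix m m ℂ) : ℝ :=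
  ‖Matrix.toEuclideanCLM (𝕜 := ℂ) A‖

/-- A density matrix: positive semidefinite with unit trace. -/
def IsDensity {m : Type*} [Fintype m] (ρ : Matrix m m ℂ) : Prop :=
  ρ.PosSemidef ∧ ρ.trace = 1

/-- The (real) energy `Tr[Hρ]`. -/
def energy {m : Type*} [Fintype m] (H ρ : Matrix m m ℂ) : ℝ :=
  ((H * ρ).trace).re

/-- Von Neumann entropy via eigenvalues. -/
def entropy {m : Type*} [Fintype m] [DecidableEq m] (ρ : Matrix m m ℂ) : ℝ :=
  if h : ρ.IsHermitian then -∑ i, h.eigenvalues i * Real.log (h.eigenvalues i) else 0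

/-- The free-energy functional at inverse temperature `β`. -/
def freeEnergyFun {m : Type*} [Fintype m] [DecidableEq m] (β : ℝ) (H ρ : Matrix m m ℂ) : ℝ :=
  energy H ρ - entropy ρ / β

/-- The free energy: the infimum of the free-energy functional over density matrices. -/
def freeEnergy {m : Type*} [Fintype m] [DecidableEq m] (β : ℝ) (H : Matrix m m ℂ) : ℝ :=
  sInf {x : ℝ | ∃ ρ, IsDensity ρ ∧ x = freeEnergyFun β H ρ}

/-- `A` acts (nontrivially) only on the sites in `e`. -/
def ActsOn {n : ℕ} {α : Type*} [Fintype α] [DecidableEq α]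
    (A : Matrix (Fin n → α) (Fin n → α) ℂ) (e : Finset (Fin n)) : Prop :=
  ∃ M : Matrix ({u // u ∈ e} → α) ({u // u ∈ e} → α) ℂ,
    ∀ x y, A x y =
      (if ∀ u ∉ e, x u = y u then (1 : ℂ) else 0) *
        M (fun u => x u.1) (fun u => y u.1)

/-- Tensor-product (product) state built from single-site matrices. -/
def prodState {n : ℕ} {α : Type*} [Fintype α] (σ : Fin n → Matrix α α ℂ) :
    Matrix (Fin n → α) (Fin n → α) ℂ :=
  fun x y => ∏ u, σ u (x u) (y u)

/-- A separable state: a finite convex combination of product states. -/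
def IsSeparable {n : ℕ} {α : Type*} [Fintype α] [DecidableEq α]
    (σ : Matrix (Fin n → α) (Fin n → α) ℂ) : Prop :=
  ∃ (N : ℕ) (p : Fin N → ℝ) (τ : Fin N → Fin n → Matrix α α ℂ),
    (∀ i, 0 ≤ p i) ∧ (∑ i, p i = 1) ∧ (∀ i u, IsDensity (τ i u)) ∧
    σ = ∑ i, (p i : ℂ) • prodState (τ i)

set_option linter.unusedSectionVars false
section Prod
open scoped MatrixOrder Matrix.Norms.L2Operator
variable {n : ℕ} {α : Type*} [Fintype α] [DecidableEq α]

lemma prodState_mul (A B : Fin n → Matrix α α ℂ) :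
    prodState A * prodState B = prodState (fun u => A u * B u) := by
  ext x y
  simp only [Matrix.mul_apply, prodState, Finset.prod_univ_sum, Fintype.piFinset_univ,
    Finset.prod_mul_distrib]

lemma prodState_sum {κ : Type*} [Fintype κ] [DecidableEq κ] (O : Fin n → κ → Matrix α α ℂ) :
    ∑ i : Fin n → κ, prodState (fun u => O u (i u)) = prodState (fun u => ∑ j, O u j) := by
  ext x y
  simp only [Matrix.sum_apply, prodState, Finset.prod_univ_sum, Fintype.piFinset_univ]

lemma prodState_trace (A : Fin n → Matrix α α ℂ) :
    (prodState A).trace = ∏ u, (A u).trace := by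
  simp only [Matrix.trace, prodState, Finset.prod_univ_sum, Fintype.piFinset_univ, Matrix.diag]

lemma prodState_one : prodState (fun _ : Fin n => (1 : Matrix α α ℂ)) = 1 := by
  ext x y
  simp only [prodState, Matrix.one_apply, Finset.prod_ite_zero, Finset.prod_const_one, funext_iff,
    Finset.mem_univ, true_imp_iff]

lemma prodState_conjTranspose (A : Fin n → Matrix α α ℂ) :
    (prodState A).conjTranspose = prodState (fun u => (A u).conjTranspose) := by
  ext x y
  simp [prodState, Matrix.conjTranspose_apply]

lemma prodState_posSemidef (A : Fin n → Matrix α α ℂ) (hA : ∀ u, (A u).PosSemidef) :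
    (prodState A).PosSemidef := by
  have : ∀ u, ∃ B : Matrix α α ℂ, A u = B.conjTranspose * B := fun u =>
    (CStarAlgebra.nonneg_iff_eq_star_mul_self (a := A u)).1 (Matrix.nonneg_iff_posSemidef.2 (hA u))
  choose B hB using this
  have h : prodState A = (prodState B).conjTranspose * prodState B := by
    rw [prodState_conjTranspose, prodState_mul]
    congr 1; funext u; exact hB u
  rw [h]
  exact Matrix.posSemidef_conjTranspose_mul_self _

lemma prodState_density (A : Fin n → Matrix α α ℂ) (hA : ∀ u, IsDensity (A u)) :
    IsDensity (prodState A) := by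
  refine ⟨prodState_posSemidef A fun u => (hA u).1, ?_⟩
  rw [prodState_trace]; simp [fun u => (hA u).2]

/-- expectation of a product operator -/
def ev (ρ : Matrix (Fin n → α) (Fin n → α) ℂ) (O : Fin n → Matrix α α ℂ) : ℂ :=
  (ρ * prodState O).trace

lemma ev_sum {κ : Type*} [Fintype κ] [DecidableEq κ] (ρ : Matrix (Fin n → α) (Fin n → α) ℂ)
    (O : Fin n → κ → Matrix α α ℂ) :
    ∑ i : Fin n → κ, ev ρ (fun u => O u (i u)) = ev ρ (fun u => ∑ j, O u j) := by
  simp only [ev, ← prodState_sum, Finset.mul_sum, Matrix.trace_sum]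

lemma prodState_update_apply (O : Fin n → Matrix α α ℂ) (u : Fin n) (X : Matrix α α ℂ)
    (x y : Fin n → α) : prodState (Function.update O u X) x y =
      X (x u) (y u) * ∏ w ∈ Finset.univ.erase u, O w (x w) (y w) := by
  rw [prodState, ← Finset.mul_prod_erase _ _ (Finset.mem_univ u)]
  congr 1
  · simp
  · refine Finset.prod_congr rfl fun w hw => ?_
    rw [Function.update_of_ne (Finset.ne_of_mem_erase hw)]

lemma prodState_update_add (O : Fin n → Matrix α α ℂ) (u : Fin n) (X Y : Matrix α α ℂ) :
    prodState (Function.update O u (X + Y)) =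
      prodState (Function.update O u X) + prodState (Function.update O u Y) := by
  ext x y
  simp only [Matrix.add_apply, prodState_update_apply, add_mul]

lemma prodState_update_smul (O : Fin n → Matrix α α ℂ) (u : Fin n) (c : ℂ) (X : Matrix α α ℂ) :
    prodState (Function.update O u (c • X)) = c • prodState (Function.update O u X) := by
  ext x y
  simp only [Matrix.smul_apply, prodState_update_apply, smul_eq_mul, mul_assoc]

/-- linear functional at a site -/
def evL (ρ : Matrix (Fin n → α) (Fin n → α) ℂ) (O : Fin n → Matrix α α ℂ) (u : Fin n) :
    Matrix α α ℂ →ₗ[ℂ] ℂ where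
  toFun X := ev ρ (Function.update O u X)
  map_add' X Y := by simp [ev, prodState_update_add, mul_add]
  map_smul' c X := by simp [ev, prodState_update_smul]

lemma evL_apply (ρ : Matrix (Fin n → α) (Fin n → α) ℂ) (O : Fin n → Matrix α α ℂ) (u : Fin n)
    (X : Matrix α α ℂ) : evL ρ O u X = ev ρ (Function.update O u X) := rfl

/-- reduced matrix at a site -/
def red (ρ : Matrix (Fin n → α) (Fin n → α) ℂ) (O : Fin n → Matrix α α ℂ) (u : Fin n) :
    Matrix α α ℂ := fun j k => evL ρ O u (Matrix.single k j 1)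

lemma red_trace (ρ : Matrix (Fin n → α) (Fin n → α) ℂ) (O : Fin n → Matrix α α ℂ) (u : Fin n)
    (X : Matrix α α ℂ) : (red ρ O u * X).trace = ev ρ (Function.update O u X) := by
  rw [← evL_apply]
  conv_rhs => rw [Matrix.matrix_eq_sum_single X]
  simp only [map_sum, Matrix.trace, Matrix.diag, Matrix.mul_apply, red]
  rw [Finset.sum_comm]
  refine Finset.sum_congr rfl fun i _ => Finset.sum_congr rfl fun j _ => ?_
  have : Matrix.single i j (X i j) = X i j • Matrix.single i j (1 : ℂ) := by simp
  rw [this, map_smul, smul_eq_mul, mul_comm]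

lemma trace_mul_nonneg {m : Type*} [Fintype m] [DecidableEq m] (A B : Matrix m m ℂ)
    (hA : A.PosSemidef) (hB : B.PosSemidef) : 0 ≤ (A * B).trace := by
  obtain ⟨C, hC⟩ := (CStarAlgebra.nonneg_iff_eq_star_mul_self (a := B)).1
    (Matrix.nonneg_iff_posSemidef.2 hB)
  rw [hC, ← mul_assoc, Matrix.trace_mul_comm, ← mul_assoc]
  have := hA.mul_mul_conjTranspose_same C
  exact this.trace_nonneg

lemma ev_nonneg {ρ : Matrix (Fin n → α) (Fin n → α) ℂ} (hρ : ρ.PosSemidef)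
    {O : Fin n → Matrix α α ℂ} (hO : ∀ u, (O u).PosSemidef) : 0 ≤ ev ρ O :=
  trace_mul_nonneg _ _ hρ (prodState_posSemidef O hO)

lemma posSemidef_of_trace {m : Type*} [Fintype m] [DecidableEq m] (A : Matrix m m ℂ)
    (h : ∀ X : Matrix m m ℂ, X.PosSemidef → 0 ≤ (A * X).trace) : A.PosSemidef := by
  have key : ∀ x : m → ℂ, 0 ≤ star x ⬝ᵥ A.mulVec x := by
    intro x
    have := h _ (Matrix.posSemidef_vecMulVec_self_star x)
    rwa [Matrix.mul_vecMulVec, Matrix.trace_vecMulVec, dotProduct_comm] at this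
  rw [← Matrix.isPositive_toEuclideanLin_iff, LinearMap.isPositive_iff_complex]
  intro x
  have h1 := key x.ofLp
  have h2 : inner ℂ (A.toEuclideanLin x) x = star (star x.ofLp ⬝ᵥ A.mulVec x.ofLp) := by
    rw [EuclideanSpace.inner_eq_star_dotProduct, Matrix.star_dotProduct, star_star,
      dotProduct_comm]
    rfl
  rw [Complex.nonneg_iff] at h1
  rw [h2]
  constructor
  · apply Complex.ext
    · simp
    · simp [← h1.2]
  · simpa using h1.1

lemma red_posSemidef {ρ : Matrix (Fin n → α) (Fin n → α) ℂ} (hρ : ρ.PosSemidef)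
    {O : Fin n → Matrix α α ℂ} (hO : ∀ u, (O u).PosSemidef) (u : Fin n) :
    (red ρ O u).PosSemidef := by
  apply posSemidef_of_trace
  intro X hX
  rw [red_trace]
  apply ev_nonneg hρ
  intro w
  by_cases h : w = u
  · subst h; simpa using hX
  · simpa [h] using hO w
end Prod
section Ent
variable {m : Type*} [Fintype m] [DecidableEq m]
open Matrix

lemma spec {ρ : Matrix m m ℂ} (h : ρ.IsHermitian) : ∃ (U : Matrix m m ℂ) (l : m → ℝ),
    U * Uᴴ = 1 ∧ Uᴴ * U = 1 ∧ ρ = U * diagonal (fun i => (l i : ℂ)) * Uᴴ ∧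
    (∀ i, l i = h.eigenvalues i) := by
  refine ⟨h.eigenvectorUnitary, h.eigenvalues, ?_, ?_, ?_, fun _ => rfl⟩
  · exact Unitary.coe_mul_star_self h.eigenvectorUnitary
  · exact Unitary.coe_star_mul_self h.eigenvectorUnitary
  · exact h.spectral_theorem

lemma entropy_diag {ρ U : Matrix m m ℂ} {l : m → ℝ} (h1 : U * Uᴴ = 1)
    (h : ρ = U * diagonal (fun i => (l i : ℂ)) * Uᴴ) :
    entropy ρ = - ∑ i, l i * Real.log (l i) := by
  have hh : ρ.IsHermitian := by
    rw [h]
    apply Matrix.isHermitian_mul_mul_conjTranspose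
    apply Matrix.isHermitian_diagonal_of_self_adjoint
    ext i; simp
  rw [entropy, dif_pos hh]
  have h2 : Uᴴ * U = 1 := mul_eq_one_comm.1 h1
  have hc : ρ.charpoly = ∏ i, (Polynomial.X - Polynomial.C (l i : ℂ)) := by
    rw [h, charpoly_mul_comm, ← mul_assoc, h2, one_mul, charpoly_diagonal]
  have hr := hh.roots_charpoly_eq_eigenvalues
  have hp : ∏ i, (Polynomial.X - Polynomial.C (l i : ℂ)) =
      ((Finset.univ.val.map (fun i => (l i : ℂ))).map
        (fun a => Polynomial.X - Polynomial.C a)).prod := by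
    rw [Multiset.map_map]; rfl
  rw [hc, hp, Polynomial.roots_multiset_prod_X_sub_C] at hr
  have e : ∀ f : m → ℝ, ∑ i, f i * Real.log (f i) =
      ((Finset.univ.val.map (fun i => ((f i : ℝ) : ℂ))).map
        (fun z : ℂ => z.re * Real.log z.re)).sum := by
    intro f
    rw [Multiset.map_map]; rfl
  rw [e, e]
  congr 3
  exact hr.symm

/-- spectral data of a density matrix -/
lemma spec_density {ρ : Matrix m m ℂ} (h : IsDensity ρ) : ∃ (U : Matrix m m ℂ) (l : m → ℝ),
    U * Uᴴ = 1 ∧ Uᴴ * U = 1 ∧ ρ = U * diagonal (fun i => (l i : ℂ)) * Uᴴ ∧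
    (∀ i, 0 ≤ l i) ∧ ∑ i, l i = 1 ∧ entropy ρ = - ∑ i, l i * Real.log (l i) := by
  obtain ⟨U, l, h1, h2, h3, h4⟩ := spec h.1.1
  refine ⟨U, l, h1, h2, h3, fun i => ?_, ?_, entropy_diag h1 h3⟩
  · rw [h4]; exact h.1.eigenvalues_nonneg i
  · have := h.2
    rw [h3, trace_mul_comm, ← mul_assoc, h2, one_mul, trace_diagonal] at this
    exact_mod_cast this

lemma spec_proj {ρ : Matrix m m ℂ} (h : IsDensity ρ) : ∃ (B : m → Matrix m m ℂ) (l : m → ℝ),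
    (∀ i, (B i).PosSemidef) ∧ ∑ i, B i = 1 ∧ (∀ i, (B i).trace = 1) ∧
    ρ = ∑ i, (l i : ℂ) • B i ∧ (∀ i, (ρ * B i).trace = l i) ∧
    (∀ i, 0 ≤ l i) ∧ ∑ i, l i = 1 ∧ entropy ρ = - ∑ i, l i * Real.log (l i) := by
  obtain ⟨U, l, h1, h2, h3, h4, h5, h6⟩ := spec_density h
  have hs : ∀ i : m, single i i (1 : ℂ) = diagonal (Pi.single i 1) := by
    intro i; rw [diagonal_single]
  refine ⟨fun i => U * single i i 1 * Uᴴ, l, ?_, ?_, ?_, ?_, ?_, h4, h5, h6⟩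
  · intro i
    apply PosSemidef.mul_mul_conjTranspose_same
    rw [hs]
    apply PosSemidef.diagonal
    intro j
    by_cases hj : j = i
    · subst hj; simp
    · simp [hj]
  · rw [← Finset.sum_mul, ← Finset.mul_sum, sum_single_one, mul_one, h1]
  · intro i
    rw [trace_mul_comm, ← mul_assoc, h2, one_mul, trace_single_eq_same]
  · have hd : diagonal (fun i => (l i : ℂ)) = ∑ i, single i i (l i : ℂ) := by
      rw [sum_single_eq_diagonal]
    rw [h3, hd, Finset.mul_sum, Finset.sum_mul]
    refine Finset.sum_congr rfl fun i _ => ?_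
    rw [← smul_mul_assoc, ← mul_smul_comm, smul_single, smul_eq_mul, mul_one]
  · intro i
    have : ρ * (U * single i i 1 * Uᴴ) = U * (diagonal (fun i => (l i : ℂ)) * single i i 1) * Uᴴ := by
      rw [h3]
      calc _ = U * diagonal (fun i => (l i : ℂ)) * (Uᴴ * U) * single i i 1 * Uᴴ := by
            simp only [mul_assoc]
        _ = _ := by rw [h2, mul_one]; simp only [mul_assoc]
    rw [this, trace_mul_comm, ← mul_assoc, h2, one_mul]
    simp [Matrix.trace, Matrix.diagonal_mul, single_apply]

lemma klein {κ : Type*} [Fintype κ] {ρ : Matrix m m ℂ} (h : IsDensity ρ)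
    (W : κ → Matrix m m ℂ) (hW : ∀ k, (W k).PosSemidef) (hW1 : ∑ k, W k = 1)
    (Q : κ → ℝ) (hQ : ∀ k, 0 ≤ Q k) (hQ1 : ∑ k, Q k * (W k).trace.re ≤ 1)
    (hQ0 : ∀ k, Q k = 0 → (ρ * W k).trace.re = 0) :
    entropy ρ ≤ - ∑ k, (ρ * W k).trace.re * Real.log (Q k) := by
  obtain ⟨B, l, hB, hB1, hBt, hρ, -, hl, hl1, hS⟩ := spec_proj h
  set g : m → κ → ℝ := fun i k => ((B i) * (W k)).trace.re with hg
  have g0 : ∀ i k, 0 ≤ g i k := fun i k =>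
    (Complex.nonneg_iff.1 (trace_mul_nonneg _ _ (hB i) (hW k))).1
  have g1 : ∀ i, ∑ k, g i k = 1 := by
    intro i
    simp only [hg]
    rw [← Complex.re_sum, ← trace_sum, ← Finset.mul_sum, hW1, mul_one, hBt]; simp
  have g2 : ∀ k, ∑ i, g i k = (W k).trace.re := by
    intro k
    simp only [hg]
    rw [← Complex.re_sum, ← trace_sum, ← Finset.sum_mul, hB1, one_mul]
  have g3 : ∀ k, (ρ * W k).trace.re = ∑ i, l i * g i k := by
    intro k
    rw [hρ, Finset.sum_mul, trace_sum, Complex.re_sum]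
    refine Finset.sum_congr rfl fun i _ => ?_
    simp [hg]
  have key : ∀ i k, g i k * l i - g i k * Q k ≤
      g i k * (l i * Real.log (l i)) - l i * g i k * Real.log (Q k) := by
    intro i k
    by_cases hl0 : l i = 0
    · have := mul_nonneg (g0 i k) (hQ k)
      simp [hl0]; linarith
    by_cases hq : Q k = 0
    · have h0 := hQ0 k hq
      rw [g3, Finset.sum_eq_zero_iff_of_nonneg (fun i _ => mul_nonneg (hl i) (g0 i k))] at h0
      have := h0 i (Finset.mem_univ i)
      have : g i k = 0 := by simpa [hl0] using this
      simp [this]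
    have lp : 0 < l i := lt_of_le_of_ne (hl i) (Ne.symm hl0)
    have qp : 0 < Q k := lt_of_le_of_ne (hQ k) (Ne.symm hq)
    have := Real.log_le_sub_one_of_pos (div_pos qp lp)
    rw [Real.log_div hq hl0] at this
    have h2 : l i * (Real.log (Q k) - Real.log (l i)) ≤ Q k - l i := by
      calc _ ≤ l i * (Q k / l i - 1) := mul_le_mul_of_nonneg_left this lp.le
        _ = _ := by field_simp
    nlinarith [mul_le_mul_of_nonneg_left h2 (g0 i k)]
  have tot := Finset.sum_le_sum fun i (_ : i ∈ Finset.univ) =>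
    Finset.sum_le_sum fun k (_ : k ∈ Finset.univ) => key i k
  simp only [Finset.sum_sub_distrib] at tot
  have t1 : ∑ i, ∑ k, g i k * l i = 1 := by
    simp only [← Finset.sum_mul, g1, one_mul, hl1]
  have t2 : ∑ i, ∑ k, g i k * Q k ≤ 1 := by
    rw [Finset.sum_comm]
    simp only [← Finset.sum_mul, g2]
    simpa only [mul_comm] using hQ1
  have t3 : ∑ i, ∑ k, g i k * (l i * Real.log (l i)) = ∑ i, l i * Real.log (l i) := by
    simp only [← Finset.sum_mul, g1, one_mul]
  have t4 : ∑ i, ∑ k, l i * g i k * Real.log (Q k) = ∑ k, (ρ * W k).trace.re * Real.log (Q k) := by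
    rw [Finset.sum_comm]
    simp only [← Finset.sum_mul, g3]
  rw [hS]; linarith

lemma opNorm_sub_posSemidef {h : Matrix m m ℂ} (hh : h.IsHermitian) :
    ((opNorm h : ℂ) • (1 : Matrix m m ℂ) - h).PosSemidef := by
  rw [← Matrix.isPositive_toEuclideanLin_iff]
  constructor
  · rw [Matrix.isSymmetric_toEuclideanLin_iff]
    apply Matrix.IsHermitian.sub _ hh
    simp [Matrix.IsHermitian]
  · intro x
    have e : toEuclideanLin ((opNorm h : ℂ) • (1 : Matrix m m ℂ) - h) x =
        (opNorm h : ℂ) • x - toEuclideanCLM (𝕜 := ℂ) h x := by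
      ext i
      rw [map_sub, LinearMap.sub_apply, LinearEquiv.map_smul, LinearMap.smul_apply]
      simp
    rw [e, inner_sub_left, inner_smul_left, map_sub]
    have h1 : RCLike.re (inner ℂ (toEuclideanCLM (𝕜 := ℂ) h x) x) ≤ opNorm h * ‖x‖ * ‖x‖ := by
      refine (RCLike.re_le_norm _).trans ((norm_inner_le_norm _ _).trans ?_)
      gcongr
      exact ContinuousLinearMap.le_opNorm _ _
    have h2 : RCLike.re ((starRingEnd ℂ) (opNorm h : ℂ) * inner ℂ x x) = opNorm h * ‖x‖ * ‖x‖ := by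
      rw [inner_self_eq_norm_sq_to_K, Complex.conj_ofReal]
      have : (opNorm h : ℂ) * ((‖x‖ : ℝ) : ℂ) ^ 2 = ((opNorm h * ‖x‖ * ‖x‖ : ℝ) : ℂ) := by
        push_cast; ring
      erw [this]
      exact Complex.ofReal_re _
    rw [h2]; linarith

lemma opNorm_neg (h : Matrix m m ℂ) : opNorm (-h) = opNorm h := by
  simp [opNorm]

lemma energy_le {h ρ : Matrix m m ℂ} (hh : h.IsHermitian) (hρ : IsDensity ρ) :
    energy h ρ ≤ opNorm h := by
  have := (Complex.nonneg_iff.1 (trace_mul_nonneg _ _ (opNorm_sub_posSemidef hh) hρ.1)).1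
  rw [sub_mul, trace_sub, smul_mul_assoc, one_mul, trace_smul, hρ.2] at this
  simpa [energy] using this

lemma le_energy {h ρ : Matrix m m ℂ} (hh : h.IsHermitian) (hρ : IsDensity ρ) :
    - opNorm h ≤ energy h ρ := by
  have := energy_le hh.neg hρ
  rw [opNorm_neg] at this
  have e : energy (-h) ρ = - energy h ρ := by simp [energy]
  linarith

lemma entry_le_opNorm (h : Matrix m m ℂ) (i j : m) : ‖h i j‖ ≤ opNorm h := by
  have h1 := ContinuousLinearMap.le_opNorm (toEuclideanCLM (𝕜 := ℂ) h) (EuclideanSpace.single j 1)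
  rw [PiLp.norm_single, norm_one, mul_one] at h1
  refine le_trans ?_ h1
  have := PiLp.norm_apply_le (toEuclideanCLM (𝕜 := ℂ) h (EuclideanSpace.single j 1)) i
  simpa [ofLp_toEuclideanCLM] using this

lemma entropy_le_card {ρ : Matrix m m ℂ} (hρ : IsDensity ρ) : entropy ρ ≤ Fintype.card m := by
  obtain ⟨U, l, -, -, -, hl, -, hS⟩ := spec_density hρ
  rw [hS, ← Finset.sum_neg_distrib]
  calc _ ≤ ∑ i : m, (1 : ℝ) := by
        refine Finset.sum_le_sum fun i _ => ?_
        rcases eq_or_lt_of_le (hl i) with h0 | h0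
        · simp [← h0]
        · have := Real.log_le_sub_one_of_pos (inv_pos.2 h0)
          rw [Real.log_inv] at this
          have := mul_le_mul_of_nonneg_left this h0.le
          rw [mul_sub, mul_inv_cancel₀ h0.ne'] at this
          nlinarith
    _ = _ := by simp

end Ent
section Povm
open Matrix

lemma povm_vec {d : ℕ} (j k : Fin d) (c : ℂ) (hc : c * star c = 1) :
    vecMulVec (Pi.single j 1 + c • Pi.single k 1 : Fin d → ℂ)
      (star (Pi.single j 1 + c • Pi.single k 1 : Fin d → ℂ)) =
    single j j (1 : ℂ) + star c • single j k (1 : ℂ) + c • single k j (1 : ℂ) + single k k 1 := by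
  have h1 : ∀ i : Fin d, star (Pi.single i 1 : Fin d → ℂ) = Pi.single i 1 := by
    intro i; rw [Pi.star_single]; simp
  have hs : ∀ i i' : Fin d, vecMulVec (Pi.single i 1 : Fin d → ℂ) (Pi.single i' 1) =
      single i i' (1 : ℂ) := by
    intro i i'
    rw [single_eq_single_vecMulVec_single]
  rw [star_add, star_smul, h1, h1, vecMulVec_add, add_vecMulVec, add_vecMulVec]
  simp only [vecMulVec_smul, smul_vecMulVec, hs, smul_smul]
  rw [mul_comm (star c), hc, one_smul]
  abel

lemma povm_exists (d : ℕ) (hd : 0 < d) : ∃ (M : Fin d × Fin d × Fin 4 → Matrix (Fin d) (Fin d) ℂ)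
    (D : Fin d → Fin d → Fin d × Fin d × Fin 4 → ℂ),
    (∀ a, (M a).PosSemidef) ∧ ∑ a, M a = 1 ∧
    (∀ j k, single j k (1 : ℂ) = ∑ a, D j k a • M a) ∧
    (∀ a, ∑ j, ∑ k, ‖D j k a‖ ≤ 2 * d) := by
  have hd' : (d : ℂ) ≠ 0 := by exact_mod_cast hd.ne'
  have hI : ∀ t : Fin 4, (Complex.I ^ (t : ℕ)) * star (Complex.I ^ (t : ℕ)) = 1 := by
    intro t
    rw [star_pow, ← mul_pow]; simp
  set B : Fin d × Fin d × Fin 4 → Matrix (Fin d) (Fin d) ℂ := fun a =>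
    single a.1 a.1 (1 : ℂ) + star (Complex.I ^ (a.2.2 : ℕ)) • single a.1 a.2.1 (1 : ℂ)
      + Complex.I ^ (a.2.2 : ℕ) • single a.2.1 a.1 (1 : ℂ) + single a.2.1 a.2.1 1 with hB
  have hBp : ∀ a, (B a).PosSemidef := by
    intro a
    have := povm_vec a.1 a.2.1 _ (hI a.2.2)
    simp only [hB]
    rw [← this]
    exact posSemidef_vecMulVec_self_star _
  have I3 : Complex.I ^ 3 = - Complex.I := by
    rw [pow_succ, Complex.I_sq]; ring
  have hBt : ∀ j k, ∑ t : Fin 4, B (j, k, t) = (4 : ℂ) • (single j j 1 + single k k 1) := by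
    intro j k
    simp only [hB, Finset.sum_add_distrib, ← Finset.sum_smul]
    have z2 : ∑ t : Fin 4, Complex.I ^ (t : ℕ) = 0 := by simp [Fin.sum_univ_four, I3]
    have z1 : ∑ t : Fin 4, star (Complex.I ^ (t : ℕ)) = 0 := by rw [← star_sum, z2, star_zero]
    rw [z1, z2, zero_smul, zero_smul, Finset.sum_const, Finset.sum_const, Finset.card_univ,
      Fintype.card_fin]
    module
  have hBu : ∀ j k, ∑ t : Fin 4, Complex.I ^ (t : ℕ) • B (j, k, t) = (4 : ℂ) • single j k 1 := by
    intro j k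
    simp only [hB, smul_add, smul_smul, hI, Finset.sum_add_distrib, ← Finset.sum_smul]
    simp [Fin.sum_univ_four, I3, ← pow_add]
  refine ⟨fun a => ((8 * d : ℝ)⁻¹ : ℂ) • B a,
    fun j k a => if a.1 = j ∧ a.2.1 = k then 2 * d * Complex.I ^ (a.2.2 : ℕ) else 0, ?_, ?_, ?_, ?_⟩
  · intro a
    apply (hBp a).smul
    have : (0 : ℝ) ≤ (8 * d : ℝ)⁻¹ := by positivity
    exact_mod_cast this
  · rw [← Finset.smul_sum, Fintype.sum_prod_type]
    simp only [Fintype.sum_prod_type, hBt, ← Finset.smul_sum, Finset.sum_add_distrib,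
      sum_single_one, Finset.sum_const, smul_smul, Finset.card_univ, Fintype.card_fin]
    rw [← two_smul ℂ, ← Nat.cast_smul_eq_nsmul ℂ, smul_smul, smul_smul]
    push_cast
    have : (8 * (d : ℂ))⁻¹ * 4 * (2 * d) = 1 := by field_simp; norm_num
    first
      | rw [this, one_smul]
      | (rw [← mul_assoc] at this; rw [this, one_smul])
  · intro j k
    simp only [Fintype.sum_prod_type]
    rw [Finset.sum_eq_single j]
    · rw [Finset.sum_eq_single k]
      · simp only [and_self, if_true, smul_smul]
        have : ∀ t : Fin 4, (2 * d * Complex.I ^ (t : ℕ) * ((8 * d : ℝ)⁻¹ : ℂ)) • B (j, k, t) =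
            (4 : ℂ)⁻¹ • (Complex.I ^ (t : ℕ) • B (j, k, t)) := by
          intro t
          rw [smul_smul]
          congr 1
          push_cast
          field_simp
          norm_num
        simp only [this, ← Finset.smul_sum, hBu]
        rw [smul_smul]; norm_num
      · intro b _ hb; simp [hb]
      · simp
    · intro b _ hb; simp [hb]
    · simp
  · intro a
    rw [Finset.sum_eq_single a.1]
    · rw [Finset.sum_eq_single a.2.1]
      · simp
      · intro b _ hb; simp [hb.symm]
      · simp
    · intro b _ hb; simp [hb.symm]
    · simp
end Povm
section Cond
open Matrix
variable {n : ℕ} {α : Type*} [Fintype α] [DecidableEq α] {A : Type*} [Fintype A] [DecidableEq A]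

lemma sum_update {β : Type*} [AddCommMonoid β] {𝕜 : Type*} [Field 𝕜] [CharZero 𝕜]
    [Module 𝕜 β] [Nonempty A] (v : Fin n)
    (F : (Fin n → A) → β) :
    ((Fintype.card A : 𝕜)⁻¹) • ∑ x, ∑ a, F (Function.update x v a) = ∑ x, F x := by
  have hA : (Fintype.card A : 𝕜) ≠ 0 := by exact_mod_cast Fintype.card_ne_zero
  have h : ∑ x : Fin n → A, ∑ a, F (Function.update x v a) = (Fintype.card A : 𝕜) • ∑ x, F x := by
    rw [← Fintype.sum_prod_type' (f := fun x a => F (Function.update x v a))]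
    have e : (Fintype.card A : 𝕜) • ∑ x, F x = ∑ z : (Fin n → A) × A, F z.1 := by
      rw [Fintype.sum_prod_type]
      simp [Finset.sum_const, Finset.smul_sum, ← Nat.cast_smul_eq_nsmul 𝕜]
    rw [e]
    refine Finset.sum_bij' (fun z _ => (Function.update z.1 v z.2, z.1 v))
      (fun z _ => (Function.update z.1 v z.2, z.1 v)) ?_ ?_ ?_ ?_ ?_ <;> simp
  rw [h, smul_smul, inv_mul_cancel₀ hA, one_smul]

/-- site effects -/
def eff (M : A → Matrix α α ℂ) (C : Finset (Fin n)) (x : Fin n → A) (u : Fin n) : Matrix α α ℂ :=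
  if u ∈ C then M (x u) else ((Fintype.card A : ℂ)⁻¹) • 1

/-- outcome probability -/
def pr (ρ : Matrix (Fin n → α) (Fin n → α) ℂ) (M : A → Matrix α α ℂ) (C : Finset (Fin n))
    (x : Fin n → A) : ℝ := (ev ρ (eff M C x)).re

/-- unnormalized conditional state -/
def om (ρ : Matrix (Fin n → α) (Fin n → α) ℂ) (M : A → Matrix α α ℂ) (C : Finset (Fin n))
    (x : Fin n → A) (u : Fin n) : Matrix α α ℂ :=
  ((Fintype.card A : ℂ)⁻¹) • red ρ (eff M C x) u

/-- conditional state -/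
def ta (ρ : Matrix (Fin n → α) (Fin n → α) ℂ) (M : A → Matrix α α ℂ) (C : Finset (Fin n))
    (x : Fin n → A) (u : Fin n) : Matrix α α ℂ :=
  if pr ρ M C x = 0 then ((Fintype.card α : ℂ)⁻¹) • 1 else ((pr ρ M C x : ℂ)⁻¹) • om ρ M C x u

/-- the product state after conditioning -/
def st (ρ : Matrix (Fin n → α) (Fin n → α) ℂ) (M : A → Matrix α α ℂ) (C : Finset (Fin n))
    (x : Fin n → A) (u : Fin n) : Matrix α α ℂ :=
  if u ∈ C then ((Fintype.card α : ℂ)⁻¹) • 1 else ta ρ M C x u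

lemma inv_card_nonneg (k : ℕ) : (0 : ℂ) ≤ (k : ℂ)⁻¹ := by
  have : (0 : ℝ) ≤ (k : ℝ)⁻¹ := by positivity
  have h := Complex.zero_le_real.2 this
  push_cast at h
  exact h

lemma mm_density [Nonempty α] : IsDensity (((Fintype.card α : ℂ)⁻¹) • (1 : Matrix α α ℂ)) := by
  refine ⟨PosSemidef.one.smul ?_, ?_⟩
  · exact inv_card_nonneg _
  · rw [trace_smul, trace_one, smul_eq_mul, inv_mul_cancel₀]
    exact_mod_cast Fintype.card_ne_zero

variable {ρ : Matrix (Fin n → α) (Fin n → α) ℂ} {M : A → Matrix α α ℂ}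

lemma eff_psd (hM : ∀ a, (M a).PosSemidef) (C : Finset (Fin n)) (x : Fin n → A) (u : Fin n) :
    (eff M C x u).PosSemidef := by
  unfold eff
  split_ifs
  · exact hM _
  · apply PosSemidef.one.smul
    exact inv_card_nonneg _

lemma ev_eff (hρ : IsDensity ρ) (hM : ∀ a, (M a).PosSemidef) (C : Finset (Fin n)) (x : Fin n → A) :
    ev ρ (eff M C x) = (pr ρ M C x : ℂ) := by
  have := Complex.nonneg_iff.1 (ev_nonneg hρ.1 (eff_psd hM C x))
  apply Complex.ext
  · simp [pr]
  · simp [← this.2]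

lemma pr_nonneg (hρ : IsDensity ρ) (hM : ∀ a, (M a).PosSemidef) (C : Finset (Fin n))
    (x : Fin n → A) : 0 ≤ pr ρ M C x :=
  (Complex.nonneg_iff.1 (ev_nonneg hρ.1 (eff_psd hM C x))).1

lemma ev_one (hρ : IsDensity ρ) : ev ρ (fun _ => 1) = 1 := by
  rw [ev, prodState_one, mul_one, hρ.2]

lemma card_smul_sum [Nonempty A] (X : Matrix α α ℂ) :
    ∑ _a : A, ((Fintype.card A : ℂ)⁻¹) • X = X := by
  have hA : (Fintype.card A : ℂ) ≠ 0 := by exact_mod_cast Fintype.card_ne_zero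
  rw [Finset.sum_const, Finset.card_univ, ← Nat.cast_smul_eq_nsmul ℂ, smul_smul,
    mul_inv_cancel₀ hA, one_smul]

lemma pr_sum [Nonempty A] (hρ : IsDensity ρ) (hM : ∀ a, (M a).PosSemidef) (hM1 : ∑ a, M a = 1)
    (C : Finset (Fin n)) : ∑ x, pr ρ M C x = 1 := by
  have h : ∑ x : Fin n → A, ev ρ (eff M C x) = 1 := by
    have := ev_sum ρ (fun (u : Fin n) (a : A) =>
      if u ∈ C then M a else ((Fintype.card A : ℂ)⁻¹) • (1 : Matrix α α ℂ))
    refine this.trans ?_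
    rw [← ev_one hρ]
    congr 1
    funext u
    split_ifs
    · exact hM1
    · exact card_smul_sum 1
  simp only [ev_eff hρ hM] at h
  exact_mod_cast h

lemma om_trace_mul (C : Finset (Fin n)) (x : Fin n → A) (u : Fin n) (X : Matrix α α ℂ) :
    (om ρ M C x u * X).trace =
      ev ρ (Function.update (eff M C x) u (((Fintype.card A : ℂ)⁻¹) • X)) := by
  rw [om, smul_mul_assoc, trace_smul, red_trace, ← evL_apply, ← evL_apply, map_smul]

lemma om_trace (hρ : IsDensity ρ) (hM : ∀ a, (M a).PosSemidef) {C : Finset (Fin n)} (x : Fin n → A)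
    {u : Fin n} (hu : u ∉ C) : (om ρ M C x u).trace = (pr ρ M C x : ℂ) := by
  rw [← mul_one (om ρ M C x u), om_trace_mul, ← ev_eff hρ hM]
  congr 1
  rw [Function.update_eq_self_iff, eff, if_neg hu]

lemma om_psd (hρ : IsDensity ρ) (hM : ∀ a, (M a).PosSemidef) (C : Finset (Fin n)) (x : Fin n → A)
    (u : Fin n) : (om ρ M C x u).PosSemidef := by
  apply (red_posSemidef hρ.1 (eff_psd hM C x) u).smul
  exact inv_card_nonneg _

lemma pr_smul_ta (hρ : IsDensity ρ) (hM : ∀ a, (M a).PosSemidef) {C : Finset (Fin n)}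
    (x : Fin n → A) {u : Fin n} (hu : u ∉ C) :
    (pr ρ M C x : ℂ) • ta ρ M C x u = om ρ M C x u := by
  unfold ta
  split_ifs with h
  · rw [h]
    have := om_trace hρ hM x hu
    rw [h, Complex.ofReal_zero, (om_psd hρ hM C x u).trace_eq_zero_iff] at this
    simp [this]
  · rw [smul_smul, mul_inv_cancel₀ (by exact_mod_cast h), one_smul]

lemma ta_density [Nonempty α] (hρ : IsDensity ρ) (hM : ∀ a, (M a).PosSemidef) {C : Finset (Fin n)}
    (x : Fin n → A) {u : Fin n} (hu : u ∉ C) : IsDensity (ta ρ M C x u) := by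
  by_cases h : pr ρ M C x = 0
  · rw [ta, if_pos h]; exact mm_density
  · have h' : (pr ρ M C x : ℂ) ≠ 0 := by exact_mod_cast h
    rw [ta, if_neg h]
    refine ⟨(om_psd hρ hM C x u).smul ?_, ?_⟩
    · have : (0 : ℝ) ≤ (pr ρ M C x)⁻¹ := inv_nonneg.2 (pr_nonneg hρ hM C x)
      exact_mod_cast this
    · rw [trace_smul, om_trace hρ hM x hu, smul_eq_mul, inv_mul_cancel₀ h']

lemma st_density [Nonempty α] (hρ : IsDensity ρ) (hM : ∀ a, (M a).PosSemidef) (C : Finset (Fin n))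
    (x : Fin n → A) (u : Fin n) : IsDensity (st ρ M C x u) := by
  unfold st
  split_ifs with h
  · exact mm_density
  · exact ta_density hρ hM x h

lemma eff_insert {C : Finset (Fin n)} {v : Fin n} (x : Fin n → A) (a : A) :
    eff M (insert v C) (Function.update x v a) = Function.update (eff M C x) v (M a) := by
  funext u
  by_cases h : u = v
  · subst h; simp [eff]
  · simp [eff, h]

lemma eff_update {C : Finset (Fin n)} {v : Fin n} (hv : v ∉ C) (x : Fin n → A) (a : A) :
    eff M C (Function.update x v a) = eff M C x := by
  funext u
  by_cases h : u = v
  · subst h; simp [eff, hv]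
  · simp [eff, h]

lemma pr_update {C : Finset (Fin n)} {v : Fin n} (hv : v ∉ C) (x : Fin n → A) (a : A) :
    pr ρ M C (Function.update x v a) = pr ρ M C x := by
  rw [pr, eff_update hv, pr]

lemma om_update {C : Finset (Fin n)} {v : Fin n} (hv : v ∉ C) (x : Fin n → A) (a : A) (u : Fin n) :
    om ρ M C (Function.update x v a) u = om ρ M C x u := by
  rw [om, eff_update hv, om]

lemma ta_update {C : Finset (Fin n)} {v : Fin n} (hv : v ∉ C) (x : Fin n → A) (a : A) (u : Fin n) :
    ta ρ M C (Function.update x v a) u = ta ρ M C x u := by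
  rw [ta, om_update hv, pr_update hv, ta]

lemma pr_avg [Nonempty A] (hρ : IsDensity ρ) (hM : ∀ a, (M a).PosSemidef) (hM1 : ∑ a, M a = 1)
    {C : Finset (Fin n)} {v : Fin n} (hv : v ∉ C) (x : Fin n → A) :
    ((Fintype.card A : ℂ)⁻¹) * ∑ a, (pr ρ M (insert v C) (Function.update x v a) : ℂ) =
      pr ρ M C x := by
  simp only [← ev_eff hρ hM, eff_insert, ← evL_apply, ← map_sum, hM1]
  rw [← smul_eq_mul, ← map_smul, evL_apply]
  congr 1
  rw [Function.update_eq_self_iff, eff, if_neg hv]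

lemma om_avg [Nonempty A] (hM1 : ∑ a, M a = 1)
    {C : Finset (Fin n)} {v : Fin n} (hv : v ∉ C) (x : Fin n → A) {u : Fin n} (huv : u ≠ v) :
    ((Fintype.card A : ℂ)⁻¹) • ∑ a, om ρ M (insert v C) (Function.update x v a) u =
      om ρ M C x u := by
  simp only [om, ← Finset.smul_sum]
  congr 1
  ext j k
  simp only [Matrix.smul_apply, Matrix.sum_apply, red, evL_apply, eff_insert, Function.update_comm huv.symm]
  simp only [← evL_apply _ (Function.update (eff M C x) u _) v, ← map_sum, hM1]
  rw [← map_smul, evL_apply, Function.update_comm huv]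
  congr 2
  rw [Function.update_eq_self_iff, eff, if_neg hv]

end Cond
section EntIneq
open Matrix
variable {n : ℕ} {α : Type*} [Fintype α] [DecidableEq α] {A : Type*} [Fintype A] [DecidableEq A]

lemma mul_log_prod (P : ℝ) (f : Fin n → ℝ) (h : ∀ u, f u = 0 → P = 0) :
    P * Real.log (∏ u, f u) = ∑ u, P * Real.log (f u) := by
  by_cases hP : P = 0
  · simp [hP]
  · rw [Real.log_prod (fun u _ hu => hP (h u hu)), Finset.mul_sum]

lemma prodState_diagonal (l : Fin n → α → ℂ) :
    prodState (fun u => diagonal (l u)) = diagonal (fun x => ∏ u, l u (x u)) := by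
  ext x y
  simp only [prodState, diagonal_apply, Finset.prod_ite_zero, Finset.mem_univ, true_imp_iff,
    funext_iff]

lemma entropy_prod (σ : Fin n → Matrix α α ℂ) (hσ : ∀ u, IsDensity (σ u)) :
    entropy (prodState σ) = ∑ u, entropy (σ u) := by
  choose U l h1 h2 h3 h4 h5 h6 using fun u => spec_density (hσ u)
  have e : prodState σ = prodState U * diagonal (fun x => ((∏ u, l u (x u) : ℝ) : ℂ)) *
      (prodState U)ᴴ := by
    push_cast
    rw [← prodState_diagonal (fun u i => (l u i : ℂ)), prodState_conjTranspose, prodState_mul,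
      prodState_mul]
    congr 1
    funext u; exact h3 u
  have eU : prodState U * (prodState U)ᴴ = 1 := by
    rw [prodState_conjTranspose, prodState_mul]
    simp only [h1, prodState_one]
  rw [entropy_diag eU e]
  simp only [h6, Finset.sum_neg_distrib]
  congr 1
  have : ∀ x : Fin n → α, (∏ u, l u (x u)) * Real.log (∏ u, l u (x u)) =
      ∑ u, (∏ w, l w (x w)) * Real.log (l u (x u)) := fun x =>
    mul_log_prod _ _ (fun u hu => Finset.prod_eq_zero (Finset.mem_univ u) hu)
  simp only [this]
  rw [Finset.sum_comm]
  refine Finset.sum_congr rfl fun u _ => ?_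
  have e2 : ∀ x : Fin n → α, (∏ w, l w (x w)) * Real.log (l u (x u)) =
      ∏ w, (l w (x w) * if w = u then Real.log (l u (x w)) else 1) := by
    intro x
    rw [Finset.prod_mul_distrib, Finset.prod_ite_eq' Finset.univ u]
    simp
  simp only [e2]
  rw [← Fintype.piFinset_univ, ← Finset.prod_univ_sum (fun _ => Finset.univ)
    (fun w j => l w j * if w = u then Real.log (l u j) else 1)]
  rw [Finset.prod_eq_single u]
  · simp
  · intro w _ hw; simp [hw, h5]
  · simp

variable {ρ : Matrix (Fin n → α) (Fin n → α) ℂ} {M : A → Matrix α α ℂ}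

lemma entropy_le_avg [Nonempty A] [Nonempty α] (hρ : IsDensity ρ) (hM : ∀ a, (M a).PosSemidef)
    (hM1 : ∑ a, M a = 1) (C : Finset (Fin n)) :
    entropy ρ ≤ ∑ x, pr ρ M C x * entropy (prodState (st ρ M C x)) := by
  choose B l hB hB1 hBt hst hl hl0 hl1 hS using
    fun x u => spec_proj (st_density hρ hM C x u)
  set w : (Fin n → A) → Fin n → α → Matrix α α ℂ := fun x u j =>
    if u ∈ C then ((Fintype.card α : ℂ)⁻¹) • M (x u) else ((Fintype.card A : ℂ)⁻¹) • B x u j with hw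
  have hwp : ∀ x u j, (w x u j).PosSemidef := by
    intro x u j
    simp only [hw]
    split_ifs
    · exact (hM _).smul (inv_card_nonneg _)
    · exact (hB _ _ _).smul (inv_card_nonneg _)
  have hws : ∀ x u, ∑ j, w x u j = eff M C x u := by
    intro x u
    simp only [hw, eff]
    split_ifs
    · exact card_smul_sum _
    · rw [← Finset.smul_sum, hB1]
  have key : ∀ x u (g : α → ℂ), ∑ i : Fin n → α, g (i u) * ev ρ (fun v => w x v (i v)) =
      pr ρ M C x * ∑ j, g j * l x u j := by
    intro x u g
    have e1 : ∀ i : Fin n → α, g (i u) * ev ρ (fun v => w x v (i v)) =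
        ev ρ (fun v => (if v = u then g (i v) else 1) • w x v (i v)) := by
      intro i
      have a1 : (fun v => w x v (i v)) = Function.update (fun v => w x v (i v)) u (w x u (i u)) := by
        rw [eq_comm, Function.update_eq_self_iff]
      have a2 : (fun v => (if v = u then g (i v) else 1) • w x v (i v)) =
          Function.update (fun v => w x v (i v)) u (g (i u) • w x u (i u)) := by
        funext v
        by_cases h : v = u
        · subst h; simp
        · simp [h]
      rw [a2, ← evL_apply, map_smul, evL_apply, smul_eq_mul, ← a1]
    simp only [e1]
    rw [ev_sum ρ (fun v j => (if v = u then g j else 1) • w x v j)]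
    have e2 : (fun v => ∑ j, (if v = u then g j else 1) • w x v j) =
        Function.update (eff M C x) u (∑ j, g j • w x u j) := by
      funext v
      by_cases h : v = u
      · subst h; simp
      · simp [h, hws]
    rw [e2]
    by_cases hu : u ∈ C
    · have hlu : ∀ j, (l x u j : ℂ) = (Fintype.card α : ℂ)⁻¹ := by
        intro j
        rw [← hl, st, if_pos hu, smul_mul_assoc, one_mul, trace_smul, hBt, smul_eq_mul, mul_one]
      have hwu : ∀ j, w x u j = ((Fintype.card α : ℂ)⁻¹) • eff M C x u := by
        intro j
        simp only [hw, eff, if_pos hu]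
      simp only [hlu, hwu, smul_smul, ← Finset.sum_smul]
      rw [← evL_apply, map_smul, evL_apply, Function.update_eq_self, ev_eff hρ hM, smul_eq_mul,
        mul_comm]
    · have hlu : ∀ j, (pr ρ M C x : ℂ) * (l x u j : ℂ) = (om ρ M C x u * B x u j).trace := by
        intro j
        rw [← hl, st, if_neg hu, ← pr_smul_ta hρ hM x hu, smul_mul_assoc, trace_smul, smul_eq_mul]
      have hwu : ∑ j, g j • w x u j = ((Fintype.card A : ℂ)⁻¹) • ∑ j, g j • B x u j := by
        simp only [hw, if_neg hu, Finset.smul_sum]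
        refine Finset.sum_congr rfl fun j _ => smul_comm _ _ _
      rw [hwu, ← om_trace_mul, Finset.mul_sum, Finset.mul_sum, trace_sum]
      refine Finset.sum_congr rfl fun j _ => ?_
      rw [mul_smul_comm, trace_smul, ← hlu, smul_eq_mul]
      ring
  have ev0 : ∀ x (i : Fin n → α), 0 ≤ ev ρ (fun v => w x v (i v)) := fun x i =>
    ev_nonneg hρ.1 (fun v => hwp x v _)
  have hz : ∀ x (i : Fin n → α) u, l x u (i u) = 0 → ev ρ (fun v => w x v (i v)) = 0 := by
    intro x i u hu
    have := key x u (fun j => if j = i u then 1 else 0)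
    simp only [ite_mul, one_mul, zero_mul, Finset.sum_ite_eq', Finset.mem_univ, if_true, hu,
      Complex.ofReal_zero, mul_zero] at this
    rw [Finset.sum_eq_zero_iff_of_nonneg] at this
    · simpa using this i (Finset.mem_univ i)
    · intro i' _
      split_ifs
      · exact ev0 x i'
      · exact le_rfl
  have main := klein (κ := (Fin n → A) × (Fin n → α)) hρ
    (fun k => prodState (fun u => w k.1 u (k.2 u)))
    (fun k => prodState_posSemidef _ fun u => hwp _ _ _) ?_
    (fun k => ∏ u, l k.1 u (k.2 u)) (fun k => Finset.prod_nonneg fun u _ => hl0 _ _ _) ?_ ?_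
  · refine main.trans (le_of_eq ?_)
    rw [Fintype.sum_prod_type, ← Finset.sum_neg_distrib]
    refine Finset.sum_congr rfl fun x _ => ?_
    rw [entropy_prod _ (st_density hρ hM C x), Finset.mul_sum]
    have e3 : ∀ i : Fin n → α, (ρ * prodState (fun u => w x u (i u))).trace.re *
        Real.log (∏ u, l x u (i u)) =
        ∑ u, (ev ρ (fun v => w x v (i v))).re * Real.log (l x u (i u)) := by
      intro i
      refine mul_log_prod _ _ (fun u hu => ?_)
      have := hz x i u hu
      rw [ev] at this
      rw [this, Complex.zero_re]
    simp only [e3]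
    rw [Finset.sum_comm, ← Finset.sum_neg_distrib]
    refine Finset.sum_congr rfl fun u _ => ?_
    have k1 := congrArg Complex.re (key x u (fun j => (Real.log (l x u j) : ℂ)))
    rw [Complex.re_sum] at k1
    rw [hS, mul_neg]
    congr 1
    have k2 : (∑ j, (Real.log (l x u j) : ℂ) * (l x u j : ℂ)) =
      ((∑ j, l x u j * Real.log (l x u j) : ℝ) : ℂ) := by
      push_cast
      exact Finset.sum_congr rfl fun j _ => mul_comm _ _
    rw [k2, ← Complex.ofReal_mul, Complex.ofReal_re] at k1
    rw [← k1]
    refine Finset.sum_congr rfl fun i _ => ?_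
    rw [Complex.re_ofReal_mul, mul_comm]
  · rw [Fintype.sum_prod_type]
    have : ∀ x, ∑ i : Fin n → α, prodState (fun u => w x u (i u)) = prodState (eff M C x) := by
      intro x
      rw [prodState_sum]
      congr 1
      funext u; exact hws x u
    simp only [this]
    have h2 := prodState_sum (fun (u : Fin n) (a : A) =>
      if u ∈ C then M a else ((Fintype.card A : ℂ)⁻¹) • (1 : Matrix α α ℂ))
    refine h2.trans ?_
    rw [← prodState_one]
    congr 1
    funext u
    split_ifs
    · exact hM1
    · exact card_smul_sum 1
  · have hc : ∑ k : (Fin n → A) × (Fin n → α), ((∏ u, l k.1 u (k.2 u) : ℝ) : ℂ) *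
        (prodState (fun u => w k.1 u (k.2 u))).trace = 1 := by
      rw [Fintype.sum_prod_type]
      have s1 : ∀ x, ∑ i : Fin n → α, ((∏ u, l x u (i u) : ℝ) : ℂ) *
          (prodState (fun u => w x u (i u))).trace =
          ∏ u, (if u ∈ C then (Fintype.card α : ℂ)⁻¹ * (M (x u)).trace
            else (Fintype.card A : ℂ)⁻¹) := by
        intro x
        simp only [prodState_trace, Complex.ofReal_prod, ← Finset.prod_mul_distrib]
        rw [← Fintype.piFinset_univ, ← Finset.prod_univ_sum (fun _ => Finset.univ)
          (fun u j => (l x u j : ℂ) * (w x u j).trace)]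
        refine Finset.prod_congr rfl fun u _ => ?_
        have hlc : ∑ j, (l x u j : ℂ) = 1 := by exact_mod_cast hl1 x u
        simp only [hw]
        split_ifs
        · rw [← Finset.sum_mul, hlc, one_mul, trace_smul, smul_eq_mul]
        · simp only [trace_smul, hBt, smul_eq_mul, mul_one]
          rw [← Finset.sum_mul, hlc, one_mul]
      simp only [s1]
      rw [← Fintype.piFinset_univ, ← Finset.prod_univ_sum (fun _ => Finset.univ)
          (fun u a => if u ∈ C then (Fintype.card α : ℂ)⁻¹ * (M a).trace
            else (Fintype.card A : ℂ)⁻¹)]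
      refine Finset.prod_eq_one fun u _ => ?_
      split_ifs
      · rw [← Finset.mul_sum, ← trace_sum, hM1, trace_one, inv_mul_cancel₀]
        exact_mod_cast Fintype.card_ne_zero
      · rw [Finset.sum_const, Finset.card_univ, nsmul_eq_mul, mul_inv_cancel₀]
        exact_mod_cast Fintype.card_ne_zero
    have := congrArg Complex.re hc
    rw [Complex.re_sum] at this
    simp only [Complex.re_ofReal_mul, Complex.one_re] at this
    exact this.le
  · intro k hk
    obtain ⟨u, -, hu⟩ := Finset.prod_eq_zero_iff.1 hk
    have := hz k.1 k.2 u hu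
    rw [ev] at this
    rw [this, Complex.zero_re]
end EntIneq
section Pairs
open Matrix
variable {n : ℕ} {α : Type*} [Fintype α] [DecidableEq α] {A : Type*} [Fintype A] [DecidableEq A]

/-- squared Frobenius norm -/
def nrm2 (X : Matrix α α ℂ) : ℝ := ∑ s : α × α, ‖X s.1 s.2‖ ^ 2

lemma nrm2_nonneg (X : Matrix α α ℂ) : 0 ≤ nrm2 X :=
  Finset.sum_nonneg fun _ _ => by positivity

/-- average purity -/
def pur (ρ : Matrix (Fin n → α) (Fin n → α) ℂ) (M : A → Matrix α α ℂ) (C : Finset (Fin n))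
    (u : Fin n) : ℝ := ∑ x, pr ρ M C x * nrm2 (ta ρ M C x u)

/-- purity increment -/
def drop (ρ : Matrix (Fin n → α) (Fin n → α) ℂ) (M : A → Matrix α α ℂ) (C : Finset (Fin n))
    (v u : Fin n) : ℝ :=
  ∑ x, pr ρ M (insert v C) x * nrm2 (ta ρ M C x u - ta ρ M (insert v C) x u)

variable {ρ : Matrix (Fin n → α) (Fin n → α) ℂ} {M : A → Matrix α α ℂ}

lemma avg_swap [Nonempty A] (v : Fin n) (f' f g : (Fin n → A) → ℂ)
    (hf : ∀ x, ((Fintype.card A : ℂ)⁻¹) * ∑ a, f' (Function.update x v a) = f x)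
    (hg : ∀ x a, g (Function.update x v a) = g x) : ∑ x, f' x * g x = ∑ x, f x * g x := by
  rw [← sum_update (𝕜 := ℂ) v, Finset.smul_sum]
  refine Finset.sum_congr rfl fun x _ => ?_
  simp only [hg]
  rw [← Finset.sum_mul, smul_eq_mul, ← mul_assoc, hf]

lemma pur_sub [Nonempty A] (hρ : IsDensity ρ) (hM : ∀ a, (M a).PosSemidef) (hM1 : ∑ a, M a = 1)
    {C : Finset (Fin n)} {u v : Fin n} (hu : u ∉ C) (hv : v ∉ C) (huv : u ≠ v) :
    pur ρ M (insert v C) u - pur ρ M C u = drop ρ M C v u := by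
  have hu' : u ∉ insert v C := by simp [hu, huv]
  simp only [pur, drop, nrm2, Finset.mul_sum]
  rw [Finset.sum_comm, Finset.sum_comm (f := fun x (s : α × α) => pr ρ M C x * _),
    Finset.sum_comm (f := fun x (s : α × α) => pr ρ M (insert v C) x *
      ‖(ta ρ M C x u - ta ρ M (insert v C) x u) s.1 s.2‖ ^ 2), ← Finset.sum_sub_distrib]
  refine Finset.sum_congr rfl fun s _ => ?_
  set z' : (Fin n → A) → ℂ := fun x => ta ρ M (insert v C) x u s.1 s.2 with hz'
  set z : (Fin n → A) → ℂ := fun x => ta ρ M C x u s.1 s.2 with hz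
  have hzu : ∀ x a, z (Function.update x v a) = z x := by
    intro x a; simp only [hz, ta_update hv]
  have e1 : ∑ x, (pr ρ M (insert v C) x : ℂ) * (z x * star (z x)) =
      ∑ x, (pr ρ M C x : ℂ) * (z x * star (z x)) :=
    avg_swap v _ _ _ (pr_avg hρ hM hM1 hv) (fun x a => by rw [hzu])
  have o1 : ∀ x, (pr ρ M (insert v C) x : ℂ) * z' x = om ρ M (insert v C) x u s.1 s.2 := by
    intro x
    rw [← pr_smul_ta hρ hM x hu']; rfl
  have o2 : ∀ x, (pr ρ M C x : ℂ) * z x = om ρ M C x u s.1 s.2 := by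
    intro x
    rw [← pr_smul_ta hρ hM x hu]; rfl
  have e2 : ∑ x, (pr ρ M (insert v C) x : ℂ) * z' x * star (z x) =
      ∑ x, (pr ρ M C x : ℂ) * z x * star (z x) := by
    apply avg_swap v
    · intro x
      simp only [o1, o2]
      rw [← om_avg hM1 hv x huv, Matrix.smul_apply, Matrix.sum_apply, smul_eq_mul]
    · intro x a; rw [hzu]
  have ns : ∀ w : ℂ, w * star w = ((‖w‖ ^ 2 : ℝ) : ℂ) := by
    intro w
    have := Complex.mul_conj' w
    push_cast; exact this
  have r1 : ∑ x, pr ρ M (insert v C) x * ‖z x‖ ^ 2 = ∑ x, pr ρ M C x * ‖z x‖ ^ 2 := by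
    simp only [ns] at e1
    exact_mod_cast e1
  have r2 : ∑ x, pr ρ M (insert v C) x * (z' x * star (z x)).re = ∑ x, pr ρ M C x * ‖z x‖ ^ 2 := by
    have := congrArg Complex.re e2
    simp only [mul_assoc, ns, Complex.re_sum, Complex.re_ofReal_mul, Complex.ofReal_re] at this
    exact this
  have r3 : ∀ x, ‖(ta ρ M C x u - ta ρ M (insert v C) x u) s.1 s.2‖ ^ 2 =
      ‖z' x‖ ^ 2 + ‖z x‖ ^ 2 - 2 * (z' x * star (z x)).re := by
    intro x
    have : (ta ρ M C x u - ta ρ M (insert v C) x u) s.1 s.2 = z x - z' x := rfl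
    rw [this, Complex.sq_norm, Complex.sq_norm, Complex.sq_norm, ← neg_sub, Complex.normSq_neg,
      Complex.normSq_sub]
    rfl
  have r4 : ∀ x, pr ρ M (insert v C) x * ‖(ta ρ M C x u - ta ρ M (insert v C) x u) s.1 s.2‖ ^ 2 =
      pr ρ M (insert v C) x * ‖z' x‖ ^ 2 + pr ρ M (insert v C) x * ‖z x‖ ^ 2
      - 2 * (pr ρ M (insert v C) x * (z' x * star (z x)).re) := by
    intro x; rw [r3]; ring
  simp only [r4, Finset.sum_sub_distrib, Finset.sum_add_distrib, ← Finset.mul_sum, r1, r2]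
  ring

lemma drop_nonneg (hρ : IsDensity ρ) (hM : ∀ a, (M a).PosSemidef) (C : Finset (Fin n))
    (v u : Fin n) : 0 ≤ drop ρ M C v u :=
  Finset.sum_nonneg fun _ _ => mul_nonneg (pr_nonneg hρ hM _ _) (nrm2_nonneg _)

lemma pur_nonneg (hρ : IsDensity ρ) (hM : ∀ a, (M a).PosSemidef) (C : Finset (Fin n))
    (u : Fin n) : 0 ≤ pur ρ M C u :=
  Finset.sum_nonneg fun _ _ => mul_nonneg (pr_nonneg hρ hM _ _) (nrm2_nonneg _)

lemma nrm2_density {X : Matrix α α ℂ} (hX : IsDensity X) : nrm2 X ≤ 1 := by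
  obtain ⟨U, l, h1, h2, h3, hl, hl1, -⟩ := spec_density hX
  have e : ((nrm2 X : ℝ) : ℂ) = (X * Xᴴ).trace := by
    simp only [nrm2, Matrix.trace, Matrix.diag, Matrix.mul_apply, conjTranspose_apply]
    rw [Fintype.sum_prod_type]
    push_cast
    refine Finset.sum_congr rfl fun i _ => Finset.sum_congr rfl fun j _ => ?_
    exact (Complex.mul_conj' _).symm
  have e2 : (X * Xᴴ).trace = ((∑ i, l i ^ 2 : ℝ) : ℂ) := by
    rw [hX.1.1.eq]
    have : X * X = U * (diagonal (fun i => (l i : ℂ)) * diagonal (fun i => (l i : ℂ))) * Uᴴ := by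
      rw [h3]
      calc _ = U * diagonal (fun i => (l i : ℂ)) * (Uᴴ * U) * diagonal (fun i => (l i : ℂ)) * Uᴴ := by
            simp only [mul_assoc]
        _ = _ := by rw [h2, mul_one]; simp only [mul_assoc]
    rw [this, trace_mul_comm, ← mul_assoc, h2, one_mul, diagonal_mul_diagonal, trace_diagonal]
    push_cast
    exact Finset.sum_congr rfl fun i _ => (sq _).symm
  have e3 : nrm2 X = ∑ i, l i ^ 2 := by exact_mod_cast e.trans e2
  rw [e3, ← hl1]
  refine Finset.sum_le_sum fun i _ => ?_
  have : l i ≤ 1 := by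
    rw [← hl1]; exact Finset.single_le_sum (fun j _ => hl j) (Finset.mem_univ i)
  nlinarith [hl i]

lemma pur_le_one [Nonempty A] [Nonempty α] (hρ : IsDensity ρ) (hM : ∀ a, (M a).PosSemidef)
    (hM1 : ∑ a, M a = 1) {C : Finset (Fin n)} {u : Fin n} (hu : u ∉ C) : pur ρ M C u ≤ 1 := by
  rw [← pr_sum hρ hM hM1 C]
  refine Finset.sum_le_sum fun x _ => ?_
  exact mul_le_of_le_one_right (pr_nonneg hρ hM _ _) (nrm2_density (ta_density hρ hM x hu))

/-- two-site operator -/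
def ee (u v : Fin n) (X Y : Matrix α α ℂ) : Fin n → Matrix α α ℂ :=
  Function.update (Function.update (fun _ => 1) u X) v Y

lemma ee_apply {u v : Fin n} (huv : u ≠ v) (X Y : Matrix α α ℂ) (x y : Fin n → α) :
    prodState (ee u v X Y) x y = X (x u) (y u) * Y (x v) (y v) *
      (if ∀ w ∉ ({u, v} : Finset (Fin n)), x w = y w then 1 else 0) := by
  rw [ee, prodState_update_apply,
    ← Finset.mul_prod_erase _ _ (show u ∈ Finset.univ.erase v by simp [huv])]
  rw [Function.update_self]
  have : ∏ w ∈ (Finset.univ.erase v).erase u,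
      (Function.update (fun _ => (1 : Matrix α α ℂ)) u X) w (x w) (y w) =
      (if ∀ w ∉ ({u, v} : Finset (Fin n)), x w = y w then 1 else 0) := by
    have h2 : ∏ w ∈ (Finset.univ.erase v).erase u,
      (Function.update (fun _ => (1 : Matrix α α ℂ)) u X) w (x w) (y w) =
      ∏ w ∈ (Finset.univ.erase v).erase u, (if x w = y w then (1 : ℂ) else 0) := by
      refine Finset.prod_congr rfl fun w hw => ?_
      rw [Function.update_of_ne (Finset.ne_of_mem_erase hw), Matrix.one_apply]
    rw [h2, Finset.prod_ite_zero, Finset.prod_const_one]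
    congr 1
    simp [not_or, and_imp]
  rw [this]; ring

lemma expand [Nonempty α] {h : Matrix (Fin n → α) (Fin n → α) ℂ} {u v : Fin n} (huv : u ≠ v)
    (hh : ActsOn h {u, v}) : ∃ c : α × α → α × α → ℂ, (∀ s t, ‖c s t‖ ≤ opNorm h) ∧
      h = ∑ s, ∑ t, c s t • prodState (ee u v (single s.1 s.2 1) (single t.1 t.2 1)) := by
  obtain ⟨N, hN⟩ := hh
  obtain ⟨b⟩ := ‹Nonempty α›
  set up : α → α → Fin n → α := fun i j => Function.update (Function.update (fun _ => b) u i) v j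
    with hup
  refine ⟨fun s t => h (up s.1 t.1) (up s.2 t.2), fun s t => entry_le_opNorm _ _ _, ?_⟩
  ext x y
  simp only [Matrix.sum_apply, Matrix.smul_apply, ee_apply huv, smul_eq_mul]
  have hs : ∀ (s : α × α) (a b : α), single s.1 s.2 (1 : ℂ) a b = if s = (a, b) then 1 else 0 := by
    intro s a b
    rw [single_apply]; congr 1; simp [Prod.ext_iff]
  simp only [hs]
  rw [Finset.sum_eq_single (x u, y u)]
  · rw [Finset.sum_eq_single (x v, y v)]
    · simp only [if_true, mul_one, one_mul]
      have hx : ∀ z : Fin n → α, (fun w : {w // w ∈ ({u, v} : Finset (Fin n))} => up (z u) (z v) w.1)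
          = fun w => z w.1 := by
        intro z
        funext ⟨w, hw⟩
        simp only [Finset.mem_insert, Finset.mem_singleton] at hw
        rcases hw with rfl | rfl
        · simp [hup, huv]
        · simp [hup]
      rw [hN, hN, hx, hx]
      have : ∀ w ∉ ({u, v} : Finset (Fin n)), up (x u) (x v) w = up (y u) (y v) w := by
        intro w hw
        simp only [Finset.mem_insert, Finset.mem_singleton, not_or] at hw
        simp [hup, hw.1, hw.2]
      rw [if_pos this]
      ring
    · intro t _ ht; simp [ht]
    · simp
  · intro s _ hs; simp [hs]
  · simp

lemma ev_prod {σ : Fin n → Matrix α α ℂ} (hσ : ∀ u, IsDensity (σ u)) {u v : Fin n} (huv : u ≠ v)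
    (X Y : Matrix α α ℂ) :
    ev (prodState σ) (ee u v X Y) = (σ u * X).trace * (σ v * Y).trace := by
  rw [ev, prodState_mul, prodState_trace, ← Finset.mul_prod_erase _ _ (Finset.mem_univ v),
    ← Finset.mul_prod_erase _ _ (show u ∈ Finset.univ.erase v by simp [huv])]
  rw [Finset.prod_eq_one]
  · simp [ee, huv]; ring
  · intro w hw
    simp only [Finset.mem_erase] at hw
    simp [ee, hw.1, hw.2.1, (hσ w).2]

lemma sum_R [Nonempty A] (hM1 : ∑ a, M a = 1) (C : Finset (Fin n)) (u v : Fin n)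
    (X Y : Matrix α α ℂ) :
    ∑ x : Fin n → A, ev ρ (Function.update (Function.update (eff M C x) u
      (((Fintype.card A : ℂ)⁻¹) • X)) v (((Fintype.card A : ℂ)⁻¹) • Y)) = ev ρ (ee u v X Y) := by
  have := ev_sum ρ (fun (w : Fin n) (a : A) => if w = v then ((Fintype.card A : ℂ)⁻¹) • Y else
    if w = u then ((Fintype.card A : ℂ)⁻¹) • X else
    if w ∈ C then M a else ((Fintype.card A : ℂ)⁻¹) • (1 : Matrix α α ℂ))
  convert this using 2
  · rename_i x _
    congr 1
    funext w
    by_cases h1 : w = v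
    · subst h1; simp
    · by_cases h2 : w = u
      · subst h2; simp [h1]
      · simp [h1, h2, eff]
  · funext w
    by_cases h1 : w = v
    · subst h1; simp only [if_true, card_smul_sum]; simp [ee]
    · by_cases h2 : w = u
      · subst h2; simp only [h1, if_true, if_false, card_smul_sum]; simp [ee, h1]
      · simp only [h1, h2, if_false, ee, Function.update_of_ne, ne_eq, not_false_eq_true]
        split_ifs
        · exact hM1.symm
        · exact (card_smul_sum 1).symm

lemma pair_diff [Nonempty A] [Nonempty α] (hρ : IsDensity ρ) (hM : ∀ a, (M a).PosSemidef)
    (hM1 : ∑ a, M a = 1) {C : Finset (Fin n)} {u v : Fin n} (hu : u ∉ C) (hv : v ∉ C) (huv : u ≠ v)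
    (X Y : Matrix α α ℂ) (D : A → ℂ) (hY : Y = ∑ a, D a • M a) :
    ∑ x, (pr ρ M C x : ℂ) * ev (prodState (st ρ M C x)) (ee u v X Y) - ev ρ (ee u v X Y) =
    ∑ x, ∑ a, D a * ((Fintype.card A : ℂ)⁻¹ * (pr ρ M (insert v C) (Function.update x v a) *
      ((ta ρ M C (Function.update x v a) u -
        ta ρ M (insert v C) (Function.update x v a) u) * X).trace)) := by
  have hu' : u ∉ insert v C := by simp [hu, huv]
  rw [← sum_R hM1 C, ← Finset.sum_sub_distrib]
  refine Finset.sum_congr rfl fun x _ => ?_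
  rw [ev_prod (st_density hρ hM C x) huv, st, st, if_neg hu, if_neg hv]
  have h1 : (pr ρ M C x : ℂ) * ((ta ρ M C x u * X).trace * (ta ρ M C x v * Y).trace) =
      (ta ρ M C x u * X).trace * (om ρ M C x v * Y).trace := by
    rw [← pr_smul_ta hρ hM x hv, smul_mul_assoc, trace_smul, smul_eq_mul]; ring
  have h2 : ∀ a, (om ρ M C x v * M a).trace =
      (Fintype.card A : ℂ)⁻¹ * pr ρ M (insert v C) (Function.update x v a) := by
    intro a
    rw [om_trace_mul, ← evL_apply, map_smul, evL_apply, ← eff_insert, ev_eff hρ hM, smul_eq_mul]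
  have h3 : ∀ a, ev ρ (Function.update (Function.update (eff M C x) u
      (((Fintype.card A : ℂ)⁻¹) • X)) v (M a)) = pr ρ M (insert v C) (Function.update x v a) *
      (ta ρ M (insert v C) (Function.update x v a) u * X).trace := by
    intro a
    rw [Function.update_comm huv, ← eff_insert, ← om_trace_mul,
      ← pr_smul_ta hρ hM _ hu', smul_mul_assoc, trace_smul, smul_eq_mul]
  rw [h1, hY, ← evL_apply ρ _ v, map_smul, map_sum, Finset.mul_sum, trace_sum, Finset.smul_sum,
    Finset.mul_sum, ← Finset.sum_sub_distrib]
  refine Finset.sum_congr rfl fun a _ => ?_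
  rw [map_smul, evL_apply, h3, mul_smul_comm, trace_smul, h2, ta_update hv, sub_mul, trace_sub]
  simp only [smul_eq_mul]
  ring

lemma edge_bound [Nonempty A] [Nonempty α] (hρ : IsDensity ρ) (hM : ∀ a, (M a).PosSemidef)
    (hM1 : ∑ a, M a = 1) (D : α × α → A → ℂ) (K : ℝ)
    (hD : ∀ t : α × α, single t.1 t.2 (1 : ℂ) = ∑ a, D t a • M a)
    (hK : ∀ a, ∑ t, ‖D t a‖ ≤ K) {h : Matrix (Fin n → α) (Fin n → α) ℂ}
    {C : Finset (Fin n)} {u v : Fin n} (hu : u ∉ C) (hv : v ∉ C) (huv : u ≠ v)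
    (hh : ActsOn h {u, v}) (hn : opNorm h ≤ 1) (η : ℝ) (hη : 0 < η) :
    ∑ x, pr ρ M C x * energy h (prodState (st ρ M C x)) - energy h ρ ≤
      K * ((Fintype.card α : ℝ) ^ 2 * η + drop ρ M C v u / η) := by
  obtain ⟨c, hc, he⟩ := expand huv hh
  have tr : ∀ τ : Matrix (Fin n → α) (Fin n → α) ℂ, (h * τ).trace =
      ∑ s, ∑ t, c s t * ev τ (ee u v (single s.1 s.2 1) (single t.1 t.2 1)) := by
    intro τ
    rw [trace_mul_comm]
    conv_lhs => rw [he]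
    simp only [Finset.mul_sum, trace_sum, mul_smul_comm, trace_smul, smul_eq_mul, ev]
  set Z : α × α → (Fin n → A) → ℂ := fun s x =>
    ((ta ρ M C x u - ta ρ M (insert v C) x u) * single s.1 s.2 1).trace with hZ
  set p' := pr ρ M (insert v C) with hp'
  have p0 : ∀ x, 0 ≤ p' x := pr_nonneg hρ hM _
  have d1 : ∑ x, pr ρ M C x * energy h (prodState (st ρ M C x)) - energy h ρ =
      (∑ s, ∑ t, c s t * (∑ x, ∑ a, D t a * ((Fintype.card A : ℂ)⁻¹ *
        (p' (Function.update x v a) * Z s (Function.update x v a))))).re := by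
    have : ∀ s t, ∑ x, ∑ a, D t a * ((Fintype.card A : ℂ)⁻¹ *
        (p' (Function.update x v a) * Z s (Function.update x v a))) = _ := fun s t =>
      (pair_diff hρ hM hM1 hu hv huv (single s.1 s.2 1) _ (D t) (hD t)).symm
    simp only [this, mul_sub, Finset.sum_sub_distrib]
    rw [← tr, Complex.sub_re]
    congr 1
    simp only [energy, ← Complex.re_ofReal_mul, ← Complex.re_sum]
    congr 1
    simp only [tr, Finset.mul_sum]
    rw [Finset.sum_comm]
    refine Finset.sum_congr rfl fun s _ => ?_
    rw [Finset.sum_comm]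
    refine Finset.sum_congr rfl fun t _ => Finset.sum_congr rfl fun x _ => ?_
    ring
  have d2 : ∀ s t, ‖c s t * (∑ x, ∑ a, D t a * ((Fintype.card A : ℂ)⁻¹ *
        (p' (Function.update x v a) * Z s (Function.update x v a))))‖ ≤
      ∑ x, ∑ a, ‖D t a‖ * ((Fintype.card A : ℝ)⁻¹ *
        (p' (Function.update x v a) * ‖Z s (Function.update x v a)‖)) := by
    intro s t
    rw [norm_mul]
    refine (mul_le_of_le_one_left (norm_nonneg _) ((hc s t).trans hn)).trans ?_
    refine (norm_sum_le _ _).trans (Finset.sum_le_sum fun x _ => ?_)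
    refine (norm_sum_le _ _).trans (Finset.sum_le_sum fun a _ => ?_)
    rw [norm_mul, norm_mul, norm_mul, norm_inv, Complex.norm_natCast, Complex.norm_real,
      Real.norm_of_nonneg (p0 _)]
  have d3 : ∀ s, ∑ t, ∑ x, ∑ a, ‖D t a‖ * ((Fintype.card A : ℝ)⁻¹ *
        (p' (Function.update x v a) * ‖Z s (Function.update x v a)‖)) ≤
      K * ∑ x, p' x * ‖Z s x‖ := by
    intro s
    rw [← sum_update (𝕜 := ℝ) v (fun x => p' x * ‖Z s x‖), Finset.sum_comm, smul_eq_mul,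
      Finset.mul_sum, Finset.mul_sum]
    refine Finset.sum_le_sum fun x _ => ?_
    rw [Finset.sum_comm, Finset.mul_sum, Finset.mul_sum]
    refine Finset.sum_le_sum fun a _ => ?_
    rw [← Finset.sum_mul]
    refine mul_le_mul_of_nonneg_right (hK a) ?_
    have := p0 (Function.update x v a)
    positivity
  have K0 : 0 ≤ K := le_trans (Finset.sum_nonneg fun _ _ => norm_nonneg _) (hK (Classical.arbitrary A))
  have d4 : ∀ s, ∑ x, p' x * ‖Z s x‖ ≤ η + (∑ x, p' x * ‖Z s x‖ ^ 2) / η := by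
    intro s
    have e1 : η + (∑ x, p' x * ‖Z s x‖ ^ 2) / η = ∑ x, p' x * (η + ‖Z s x‖ ^ 2 / η) := by
      simp only [mul_add, Finset.sum_add_distrib, ← Finset.sum_mul, hp', pr_sum hρ hM hM1, one_mul,
        ← mul_div_assoc, ← Finset.sum_div]
    rw [e1]
    refine Finset.sum_le_sum fun x _ => mul_le_mul_of_nonneg_left ?_ (p0 x)
    have : ‖Z s x‖ * η ≤ η * η + ‖Z s x‖ ^ 2 := by nlinarith [sq_nonneg (‖Z s x‖ - η), norm_nonneg (Z s x), mul_nonneg (norm_nonneg (Z s x)) hη.le]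
    calc ‖Z s x‖ = (‖Z s x‖ * η) / η := by field_simp
      _ ≤ (η * η + ‖Z s x‖ ^ 2) / η := by gcongr
      _ = _ := by field_simp
  have d5 : ∑ s, ∑ x, p' x * ‖Z s x‖ ^ 2 = drop ρ M C v u := by
    rw [Finset.sum_comm, drop]
    refine Finset.sum_congr rfl fun x _ => ?_
    rw [← Finset.mul_sum]
    congr 1
    rw [nrm2, ← (Equiv.prodComm α α).sum_comp]
    refine Finset.sum_congr rfl fun s _ => ?_
    simp only [hZ]
    rw [trace_mul_single]
    simp
  rw [d1]
  calc _ ≤ _ := Complex.re_le_norm _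
    _ ≤ ∑ s, ∑ t, ∑ x, ∑ a, ‖D t a‖ * ((Fintype.card A : ℝ)⁻¹ *
        (p' (Function.update x v a) * ‖Z s (Function.update x v a)‖)) :=
      (norm_sum_le _ _).trans (Finset.sum_le_sum fun s _ =>
        (norm_sum_le _ _).trans (Finset.sum_le_sum fun t _ => d2 s t))
    _ ≤ ∑ s, K * (η + (∑ x, p' x * ‖Z s x‖ ^ 2) / η) :=
      Finset.sum_le_sum fun s _ => (d3 s).trans (mul_le_mul_of_nonneg_left (d4 s) K0)
    _ = _ := by
      rw [← Finset.mul_sum, Finset.sum_add_distrib, ← Finset.sum_div, d5]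
      simp [sq]
end Pairs
section Comb
variable {n : ℕ}

lemma exists_core (P : Finset (Fin n) → Fin n → ℝ) (Dr : Finset (Fin n) → Fin n → Fin n → ℝ)
    (hP0 : ∀ C u, 0 ≤ P C u) (hP1 : ∀ C u, u ∉ C → P C u ≤ 1) (hD0 : ∀ C v u, 0 ≤ Dr C v u)
    (hsub : ∀ C u v, u ∉ C → v ∉ C → u ≠ v → P (insert v C) u - P C u = Dr C v u)
    (deg : Fin n → ℝ) (ν : ℝ) :
    ∃ C : Finset (Fin n), ν * ∑ v ∈ C, deg v ≤ n ∧
      ∀ v ∉ C, ∑ u ∈ Finset.univ.filter (fun u => u ∉ C ∧ u ≠ v), Dr C v u ≤ ν * deg v := by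
  obtain ⟨C, -, hC⟩ := Finset.exists_max_image (Finset.univ : Finset (Finset (Fin n)))
    (fun C => ∑ u, P (C.erase u) u - ν * ∑ v ∈ C, deg v) Finset.univ_nonempty
  refine ⟨C, ?_, ?_⟩
  · have h0 := hC ∅ (Finset.mem_univ _)
    have h1 : 0 ≤ ∑ u : Fin n, P ((∅ : Finset (Fin n)).erase u) u :=
      Finset.sum_nonneg fun u _ => hP0 _ _
    have h2 : ∑ u, P (C.erase u) u ≤ n := by
      calc _ ≤ ∑ u : Fin n, (1 : ℝ) :=
            Finset.sum_le_sum fun u _ => hP1 _ _ (Finset.notMem_erase u C)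
        _ = n := by simp
    simp only [Finset.sum_empty, mul_zero, sub_zero] at h0
    linarith
  · intro v hv
    have h0 := hC (insert v C) (Finset.mem_univ _)
    simp only [Finset.sum_insert hv] at h0
    have h1 : ∑ u ∈ Finset.univ.filter (fun u => u ∉ C ∧ u ≠ v), Dr C v u ≤
        ∑ u, (P ((insert v C).erase u) u - P (C.erase u) u) := by
      rw [Finset.sum_filter]
      refine Finset.sum_le_sum fun u _ => ?_
      by_cases huv : u = v
      · subst huv
        simp [Finset.erase_insert hv, Finset.erase_eq_of_notMem hv]
      · have e1 : (insert v C).erase u = insert v (C.erase u) :=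
          Finset.erase_insert_of_ne (fun h => huv h.symm)
        rw [e1, hsub (C.erase u) u v (Finset.notMem_erase u C)
          (fun h => hv (Finset.mem_of_mem_erase h)) huv]
        split_ifs with hc
        · rw [Finset.erase_eq_of_notMem hc.1]
        · exact hD0 _ _ _
    rw [Finset.sum_sub_distrib] at h1
    linarith [mul_add ν (deg v) (∑ x ∈ C, deg x)]

lemma sum_deg (E : Finset (Finset (Fin n))) (S : Finset (Fin n)) :
    ∑ v ∈ S, ((E.filter (fun e => v ∈ e)).card : ℝ) = ∑ e ∈ E, ((e ∩ S).card : ℝ) := by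
  have : ∀ v, ((E.filter (fun e => v ∈ e)).card : ℝ) = ∑ e ∈ E, if v ∈ e then (1 : ℝ) else 0 := by
    intro v
    rw [Finset.sum_boole]
  simp only [this]
  rw [Finset.sum_comm]
  refine Finset.sum_congr rfl fun e _ => ?_
  rw [Finset.sum_boole, Finset.filter_mem_eq_inter, Finset.inter_comm]

lemma edges_sum (E : Finset (Finset (Fin n))) (hE : ∀ e ∈ E, e.card = 2) (C : Finset (Fin n))
    (ν : ℝ) (hν : 0 < ν) (Dr : Fin n → Fin n → ℝ) (hD0 : ∀ v u, 0 ≤ Dr v u)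
    (h1 : ν * ∑ v ∈ C, ((E.filter (fun e => v ∈ e)).card : ℝ) ≤ n)
    (h2 : ∀ v ∉ C, ∑ u ∈ Finset.univ.filter (fun u => u ∉ C ∧ u ≠ v), Dr v u ≤
      ν * ((E.filter (fun e => v ∈ e)).card : ℝ))
    (err : Finset (Fin n) → ℝ) (he2 : ∀ e ∈ E, err e ≤ 2) (a b : ℝ) (ha : 0 ≤ a) (hb : 0 ≤ b)
    (he : ∀ u v, u ∉ C → v ∉ C → u ≠ v → ({u, v} : Finset (Fin n)) ∈ E →
      err {u, v} ≤ a + b * Dr v u) :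
    ∑ e ∈ E, err e ≤ 2 * (n / ν) + a * E.card + b * (2 * ν * E.card) := by
  classical
  rw [← Finset.sum_filter_add_sum_filter_not E (fun e => (e ∩ C).Nonempty)]
  have t1 : ∑ e ∈ E.filter (fun e => (e ∩ C).Nonempty), err e ≤ 2 * (n / ν) := by
    have : ∑ e ∈ E.filter (fun e => (e ∩ C).Nonempty), (1 : ℝ) ≤ n / ν := by
      rw [le_div_iff₀ hν, mul_comm]
      refine le_trans (mul_le_mul_of_nonneg_left ?_ hν.le) h1
      rw [sum_deg, Finset.sum_filter]
      refine Finset.sum_le_sum fun e _ => ?_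
      split_ifs with hc
      · exact_mod_cast hc.card_pos
      · positivity
    calc _ ≤ ∑ e ∈ E.filter (fun e => (e ∩ C).Nonempty), 2 * (1 : ℝ) :=
          Finset.sum_le_sum fun e h => by
            rw [mul_one]; exact he2 e (Finset.mem_filter.1 h).1
      _ ≤ _ := by rw [← Finset.mul_sum]; linarith
  set E' := E.filter (fun e => ¬ (e ∩ C).Nonempty) with hE'
  have key : ∀ e ∈ E', ∃ p : Fin n × Fin n,
      e = {p.1, p.2} ∧ p.1 ≠ p.2 ∧ p.1 ∉ C ∧ p.2 ∉ C := by
    intro e h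
    obtain ⟨hm, hn⟩ := Finset.mem_filter.1 h
    obtain ⟨u, v, huv, rfl⟩ := Finset.card_eq_two.1 (hE e hm)
    refine ⟨(u, v), rfl, huv, fun hc => hn ⟨u, ?_⟩, fun hc => hn ⟨v, ?_⟩⟩
    · simp at hc; simp [hc]
    · simp at hc; simp [hc]
  rcases E'.eq_empty_or_nonempty with hemp | ⟨e0, he0⟩
  · rw [hemp, Finset.sum_empty]
    have : 0 ≤ a * E.card + b * (2 * ν * E.card) := by positivity
    linarith
  have hne : Nonempty (Fin n × Fin n) := ⟨(key e0 he0).choose⟩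
  choose! p hp using key
  have t2 : ∑ e ∈ E', err e ≤ ∑ e ∈ E', (a + b * Dr (p e).2 (p e).1) := by
    refine Finset.sum_le_sum fun e h => ?_
    obtain ⟨g1, g2, g3, g4⟩ := hp e h
    have hm := (Finset.mem_filter.1 h).1
    have := he (p e).1 (p e).2 g3 g4 g2 (g1 ▸ hm)
    rwa [← g1] at this
  have t3 : ∑ e ∈ E', Dr (p e).2 (p e).1 ≤ 2 * ν * E.card := by
    have inj : Set.InjOn p E' := by
      intro e h e' h' hee
      rw [(hp e h).1, (hp e' h').1, hee]
    calc _ = ∑ q ∈ E'.image p, Dr q.2 q.1 := (Finset.sum_image (f := fun q => Dr q.2 q.1) inj).symm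
      _ ≤ ∑ q ∈ (Finset.univ : Finset (Fin n × Fin n)).filter
            (fun q => q.2 ∉ C ∧ q.1 ∉ C ∧ q.1 ≠ q.2), Dr q.2 q.1 := by
          refine Finset.sum_le_sum_of_subset_of_nonneg ?_ fun q _ _ => hD0 _ _
          intro q hq
          obtain ⟨e, h, rfl⟩ := Finset.mem_image.1 hq
          obtain ⟨g1, g2, g3, g4⟩ := hp e h
          simp only [Finset.mem_filter, Finset.mem_univ, true_and]
          exact ⟨g4, g3, g2⟩
      _ = ∑ v, if v ∉ C then
            ∑ u ∈ Finset.univ.filter (fun u => u ∉ C ∧ u ≠ v), Dr v u else 0 := by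
          rw [Finset.sum_filter, Fintype.sum_prod_type_right]
          refine Finset.sum_congr rfl fun v _ => ?_
          by_cases hv : v ∈ C
          · simp [hv]
          · simp only [hv, not_false_eq_true, true_and, if_true]
            rw [Finset.sum_filter]
      _ ≤ ∑ v, ν * ((E.filter (fun e => v ∈ e)).card : ℝ) := by
          refine Finset.sum_le_sum fun v _ => ?_
          split_ifs with hv
          · positivity
          · exact h2 v hv
      _ = 2 * ν * E.card := by
          rw [← Finset.mul_sum, sum_deg, Finset.sum_congr rfl (g := fun _ => (2 : ℝ))]
          · rw [Finset.sum_const, nsmul_eq_mul]; ring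
          · intro e h
            rw [Finset.inter_univ, hE e h]; norm_num
  have t4 : (E'.card : ℝ) ≤ E.card := by
    exact_mod_cast Finset.card_le_card (Finset.filter_subset _ _)
  rw [Finset.sum_add_distrib, ← Finset.mul_sum, Finset.sum_const, nsmul_eq_mul] at t2
  have t5 := mul_le_mul_of_nonneg_left t3 hb
  have t6 := mul_le_mul_of_nonneg_left t4 ha
  linarith

end Comb
section Final
open Matrix

lemma energy_sum {m : Type*} [Fintype m] {ι : Type*} (E : Finset ι) (h : ι → Matrix m m ℂ)
    (ρ : Matrix m m ℂ) : energy (∑ e ∈ E, h e) ρ = ∑ e ∈ E, energy (h e) ρ := by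
  simp only [energy]
  rw [Finset.sum_mul, trace_sum, Complex.re_sum]

lemma round_state (d : ℕ) (hd : 0 < d) (ε β : ℝ) (hε : 0 < ε) (hβ : 0 < β) (n : ℕ)
    (E : Finset (Finset (Fin n))) (h : Finset (Fin n) → Matrix (Fin n → Fin d) (Fin n → Fin d) ℂ)
    (hE : ∀ e ∈ E, e.card = 2) (hH : ∀ e ∈ E, (h e).IsHermitian) (hA : ∀ e ∈ E, ActsOn (h e) e)
    (hN : ∀ e ∈ E, opNorm (h e) ≤ 1) (hm : 3456 * (d : ℝ) ^ 4 * n / ε ^ 3 ≤ (E.card : ℝ))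
    (ρ : Matrix (Fin n → Fin d) (Fin n → Fin d) ℂ) (hρ : IsDensity ρ) :
    ∃ σ : Fin n → Matrix (Fin d) (Fin d) ℂ, (∀ u, IsDensity (σ u)) ∧
      freeEnergyFun β (∑ e ∈ E, h e) (prodState σ) ≤
        freeEnergyFun β (∑ e ∈ E, h e) ρ + ε / 2 * E.card := by
  have : Nonempty (Fin d) := ⟨⟨0, hd⟩⟩
  obtain ⟨M, D, hM, hM1, hD, hK⟩ := povm_exists d hd
  have hd' : (0 : ℝ) < d := by exact_mod_cast hd
  set η : ℝ := ε / (12 * d ^ 3) with hη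
  set ν : ℝ := ε ^ 2 / (288 * d ^ 4) with hν
  have η0 : 0 < η := by positivity
  have ν0 : 0 < ν := by positivity
  obtain ⟨C, hC1, hC2⟩ := exists_core (pur ρ M) (drop ρ M) (pur_nonneg hρ hM)
    (fun C u hu => pur_le_one hρ hM hM1 hu) (drop_nonneg hρ hM)
    (fun C u v hu hv huv => pur_sub hρ hM hM1 hu hv huv)
    (fun v => ((E.filter (fun e => v ∈ e)).card : ℝ)) ν
  have p0 := pr_nonneg hρ hM C
  have p1 := pr_sum hρ hM hM1 C
  have sd : ∀ x, IsDensity (prodState (st ρ M C x)) := fun x =>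
    prodState_density _ (st_density hρ hM C x)
  have tot := edges_sum E hE C ν ν0 (drop ρ M C) (drop_nonneg hρ hM C) hC1 hC2
    (fun e => ∑ x, pr ρ M C x * energy (h e) (prodState (st ρ M C x)) - energy (h e) ρ)
    (by
      intro e he
      have h1 : ∑ x, pr ρ M C x * energy (h e) (prodState (st ρ M C x)) ≤ 1 := by
        rw [← p1]
        refine Finset.sum_le_sum fun x _ => mul_le_of_le_one_right (p0 x) ?_
        exact (energy_le (hH e he) (sd x)).trans (hN e he)
      have h2 := le_energy (hH e he) hρ
      have h3 := hN e he
      linarith)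
    (2 * d * (d ^ 2 * η)) (2 * d / η) (by positivity) (by positivity)
    (by
      intro u v hu hv huv he
      have := edge_bound hρ hM hM1 (fun t a => D t.1 t.2 a) (2 * d) (fun t => hD t.1 t.2)
        (fun a => by rw [Fintype.sum_prod_type]; exact hK a) hu hv huv (hA _ he) (hN _ he) η η0
      rw [Fintype.card_fin] at this
      refine this.trans (le_of_eq ?_)
      ring)
  have eH : ∑ e ∈ E, (∑ x, pr ρ M C x * energy (h e) (prodState (st ρ M C x)) - energy (h e) ρ) =
      ∑ x, pr ρ M C x * energy (∑ e ∈ E, h e) (prodState (st ρ M C x)) -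
        energy (∑ e ∈ E, h e) ρ := by
    simp only [energy_sum, Finset.sum_sub_distrib, Finset.mul_sum]
    rw [Finset.sum_comm]
  have num : 2 * ((n : ℝ) / ν) + 2 * d * (d ^ 2 * η) * E.card + 2 * d / η * (2 * ν * E.card) ≤
      ε / 2 * E.card := by
    have a1 : 2 * ((n : ℝ) / ν) = ε / 6 * (3456 * (d : ℝ) ^ 4 * n / ε ^ 3) := by
      rw [hν]; field_simp; ring
    have a2 : 2 * d * (d ^ 2 * η) = ε / 6 := by
      rw [hη]; field_simp; norm_num
    have a3 : 2 * d / η * (2 * ν * E.card) = ε / 6 * E.card := by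
      rw [hη, hν]; field_simp; ring
    rw [a1, a2, a3]
    have := mul_le_mul_of_nonneg_left hm (by positivity : 0 ≤ ε / 6)
    linarith
  have ent := entropy_le_avg hρ hM hM1 C
  have avg : ∑ x, pr ρ M C x * freeEnergyFun β (∑ e ∈ E, h e) (prodState (st ρ M C x)) ≤
      ∑ x, pr ρ M C x * (freeEnergyFun β (∑ e ∈ E, h e) ρ + ε / 2 * E.card) := by
    rw [← Finset.sum_mul, p1, one_mul]
    have : ∑ x, pr ρ M C x * freeEnergyFun β (∑ e ∈ E, h e) (prodState (st ρ M C x)) =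
        ∑ x, pr ρ M C x * energy (∑ e ∈ E, h e) (prodState (st ρ M C x)) -
        (∑ x, pr ρ M C x * entropy (prodState (st ρ M C x))) / β := by
      rw [Finset.sum_div, ← Finset.sum_sub_distrib]
      refine Finset.sum_congr rfl fun x _ => ?_
      rw [freeEnergyFun]; ring
    rw [this, freeEnergyFun]
    have := div_le_div_of_nonneg_right ent hβ.le
    rw [eH] at tot
    linarith
  by_contra hcon
  push Not at hcon
  have hlt : ∀ x, freeEnergyFun β (∑ e ∈ E, h e) ρ + ε / 2 * E.card <
      freeEnergyFun β (∑ e ∈ E, h e) (prodState (st ρ M C x)) := fun x =>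
    hcon _ (st_density hρ hM C x)
  have : ∃ x, 0 < pr ρ M C x := by
    by_contra hx
    push Not at hx
    have : ∑ x, pr ρ M C x ≤ 0 := Finset.sum_nonpos fun x _ => hx x
    linarith
  obtain ⟨x0, hx0⟩ := this
  refine absurd avg (not_le.2 ?_)
  exact Finset.sum_lt_sum (fun x _ => mul_le_mul_of_nonneg_left (hlt x).le (p0 x))
    ⟨x0, Finset.mem_univ _, mul_lt_mul_of_pos_left (hlt x0) hx0⟩

lemma bdd {m : Type*} [Fintype m] [DecidableEq m] (β : ℝ) (hβ : 0 < β) (H : Matrix m m ℂ)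
    (hH : H.IsHermitian) : BddBelow {x : ℝ | ∃ ρ, IsDensity ρ ∧ x = freeEnergyFun β H ρ} := by
  refine ⟨-opNorm H - Fintype.card m / β, ?_⟩
  rintro _ ⟨ρ, hρ, rfl⟩
  have h1 := le_energy hH hρ
  have h2 := div_le_div_of_nonneg_right (entropy_le_card hρ) hβ.le
  rw [freeEnergyFun]
  linarith

end Final

/-- For every local dimension `d` there is a constant `C` such that for all
`ε > 0`, inverse temperature `β > 0`, and every 2-local Hamiltonian on `n` qudits of local
dimension `d` with `m ≥ C·n/ε³` interactions of operator norm at most 1, there is a product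
mixed state `σ` with `F(β) ≤ Tr[Hσ] − S(σ)/β ≤ F(β) + ε·m`. -/
theorem free_energy_product_state_dense_2local :
    ∀ d : ℕ, 0 < d → ∃ C : ℝ, 0 < C ∧
      ∀ (ε β : ℝ), 0 < ε → 0 < β →
      ∀ (n : ℕ) (E : Finset (Finset (Fin n)))
        (h : Finset (Fin n) → Matrix (Fin n → Fin d) (Fin n → Fin d) ℂ),
        (∀ e ∈ E, e.card = 2) →
        (∀ e ∈ E, (h e).IsHermitian) →
        (∀ e ∈ E, ActsOn (h e) e) →
        (∀ e ∈ E, opNorm (h e) ≤ 1) →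
        C * n / ε ^ 3 ≤ (E.card : ℝ) →
        ∃ σ : Fin n → Matrix (Fin d) (Fin d) ℂ,
          (∀ u, IsDensity (σ u)) ∧
          freeEnergy β (∑ e ∈ E, h e) ≤
            freeEnergyFun β (∑ e ∈ E, h e) (prodState σ) ∧
          freeEnergyFun β (∑ e ∈ E, h e) (prodState σ) ≤
            freeEnergy β (∑ e ∈ E, h e) + ε * E.card := by
  intro d hd
  have hd' : (0 : ℝ) < d := by exact_mod_cast hd
  refine ⟨3456 * (d : ℝ) ^ 4, by positivity, ?_⟩
  intro ε β hε hβ n E h hE hH hA hN hm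
  have : Nonempty (Fin d) := ⟨⟨0, hd⟩⟩
  have herm : (∑ e ∈ E, h e).IsHermitian := by
    rw [Matrix.IsHermitian, Matrix.conjTranspose_sum]
    exact Finset.sum_congr rfl fun e he => hH e he
  have hb := bdd β hβ _ herm
  have low : ∀ σ : Fin n → Matrix (Fin d) (Fin d) ℂ, (∀ u, IsDensity (σ u)) →
      freeEnergy β (∑ e ∈ E, h e) ≤ freeEnergyFun β (∑ e ∈ E, h e) (prodState σ) := fun σ hσ =>
    csInf_le hb ⟨_, prodState_density σ hσ, rfl⟩
  have dm : IsDensity (prodState (fun _ : Fin n =>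
      ((Fintype.card (Fin d) : ℂ)⁻¹) • (1 : Matrix (Fin d) (Fin d) ℂ))) :=
    prodState_density _ fun _ => mm_density
  rcases Nat.eq_zero_or_pos E.card with h0 | h0
  · have hn : n = 0 := by
      by_contra hne
      have : (0 : ℝ) < n := by exact_mod_cast Nat.pos_of_ne_zero hne
      have : 0 < 3456 * (d : ℝ) ^ 4 * n / ε ^ 3 := by positivity
      rw [h0] at hm
      push_cast at hm
      linarith
    subst hn
    refine ⟨fun _ => ((Fintype.card (Fin d) : ℂ)⁻¹) • (1 : Matrix (Fin d) (Fin d) ℂ),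
      fun _ => mm_density, low _ fun _ => mm_density, ?_⟩
    have uniq : ∀ ρ : Matrix (Fin 0 → Fin d) (Fin 0 → Fin d) ℂ, IsDensity ρ →
        ρ = fun _ _ => 1 := by
      intro ρ hρ
      have := hρ.2
      funext x y
      rw [Matrix.trace, Fintype.sum_unique] at this
      rw [Subsingleton.elim x default, Subsingleton.elim y default]
      exact this
    rw [h0, Nat.cast_zero, mul_zero, add_zero]
    refine le_csInf ⟨_, _, dm, rfl⟩ ?_
    rintro _ ⟨ρ, hρ, rfl⟩
    rw [uniq ρ hρ, uniq _ dm]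
  · have hpos : (0 : ℝ) < E.card := by exact_mod_cast h0
    have hlt : freeEnergy β (∑ e ∈ E, h e) < freeEnergy β (∑ e ∈ E, h e) + ε / 2 * E.card := by
      have : 0 < ε / 2 * E.card := by positivity
      linarith
    obtain ⟨_, ⟨ρ, hρ, rfl⟩, hρ2⟩ := exists_lt_of_csInf_lt
      (s := {x : ℝ | ∃ ρ, IsDensity ρ ∧ x = freeEnergyFun β (∑ e ∈ E, h e) ρ})
      ⟨_, _, dm, rfl⟩ hlt
    obtain ⟨σ, hσ, hσ2⟩ := round_state d hd ε β hε hβ n E h hE hH hA hN hm ρ hρ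
    refine ⟨σ, hσ, low σ hσ, ?_⟩
    linarith

end QLH
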